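/- arXiv:2307.05466 — 10 statements merged into one kernel-verified Lean document; each statement's English description precedes it below -/
import Mathlib

section
/- Fix a toll vector p ∈ ℝ^{A_O}. Then the function F(·, p) attains its minimum over the flow polytope W at exactly one point; i.e., there exists a unique w̄^β(p) ∈ W such that F(w̄^β(p), p) ≤ F(w, p) for all w ∈ W, with equality only when w = w̄^β(p). (This unique minimizer is the Condensed DAG equilibrium at p.) -/
open Finset

/-- A walk in the directed graph with arc set `A`, node set `I`, following `tail`/`head`. -/
def IsWalk {A I : Type*} (tail head : A → I) : List A → I → I → Prop
  | [], u, v => u = v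
  | a :: rest, u, v => tail a = u ∧ IsWalk tail head rest (head a) v
namespace CoDAG

section Walks

variable {A I : Type*} {tail head : A → I}

theorem IsWalk.append_single {L : List A} {u : I} {a : A} (h : IsWalk tail head L u (tail a)) :
    IsWalk tail head (L ++ [a]) u (head a) := by
  induction L generalizing u with
  | nil => exact ⟨h.symm, rfl⟩
  | cons b L ih => exact ⟨h.1, ih h.2⟩

/-- The arc relation of a finite acyclic graph is well founded. -/
theorem wellFounded_arc [Finite I]
    (h : ∀ (L : List A) (i : I), L ≠ [] → ¬ IsWalk tail head L i i) :
    WellFounded fun i j => ∃ a, tail a = i ∧ head a = j := by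
  set r : I → I → Prop := fun i j => ∃ a, tail a = i ∧ head a = j with hr
  have walk_of_transGen : ∀ i j, Relation.TransGen r i j →
      ∃ L : List A, L ≠ [] ∧ IsWalk tail head L i j := by
    intro i j hij
    induction hij with
    | single hij =>
      obtain ⟨a, rfl, rfl⟩ := hij
      exact ⟨[a], by simp, rfl, rfl⟩
    | tail _ hjk ih =>
      obtain ⟨a, rfl, rfl⟩ := hjk
      obtain ⟨L, -, hL⟩ := ih
      exact ⟨L ++ [a], by simp, IsWalk.append_single hL⟩
  have : Std.Irrefl (Relation.TransGen r) :=
    ⟨fun i hi => by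
      obtain ⟨L, hne, hL⟩ := walk_of_transGen i i hi
      exact h L i hne hL⟩
  have wf : WellFounded (Relation.TransGen r) := Finite.wellFounded_of_trans_of_irrefl _
  exact Subrelation.wf (fun hij => Relation.TransGen.single hij) wf

/-- Counting departures from and arrivals at a node along a walk. -/
theorem IsWalk.sum_count [Fintype A] [DecidableEq A] [DecidableEq I] {L : List A} {u v : I}
    (h : IsWalk tail head L u v) (i : I) :
    (∑ a ∈ univ.filter (fun a => tail a = i), L.count a) + (if i = v then 1 else 0) =
      (∑ a ∈ univ.filter (fun a => head a = i), L.count a) + (if i = u then 1 else 0) := by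
  induction L generalizing u with
  | nil =>
    have huv : u = v := h
    simp [huv]
  | cons b L ih =>
    obtain ⟨rfl, hL⟩ := h
    have hi := ih hL
    have key (f : A → I) : ∑ a ∈ univ.filter (fun a => f a = i), (b :: L).count a =
        (∑ a ∈ univ.filter (fun a => f a = i), L.count a) + if i = f b then 1 else 0 := by
      simp only [List.count_cons, Finset.sum_add_distrib, beq_iff_eq, Finset.sum_ite_eq,
        Finset.mem_filter, Finset.mem_univ, true_and, eq_comm (a := i)]
    rw [key, key]
    omega

end Walks

section Entropy

/-- The function `x log x - x log X`, the perspective of `t ↦ t log t`. -/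
noncomputable def relEntropy (x X : ℝ) : ℝ := x * Real.log x - x * Real.log X

theorem relEntropy_smul {t : ℝ} (ht : 0 < t) {x X : ℝ} (hx : 0 ≤ x) (hX : x ≤ X) :
    relEntropy (t * x) (t * X) = t * relEntropy x X := by
  rcases hx.eq_or_lt with rfl | hx
  · simp [relEntropy]
  · have hX' := hx.trans_le hX
    rw [relEntropy, relEntropy, Real.log_mul ht.ne' hx.ne', Real.log_mul ht.ne' hX'.ne']
    ring

theorem relEntropy_eq_mul {x X : ℝ} (hX : 0 < X) :
    relEntropy x X = X * (x / X * Real.log (x / X)) := by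
  rcases eq_or_ne x 0 with rfl | hx
  · simp [relEntropy]
  · rw [Real.log_div hx hX.ne', relEntropy]
    field_simp

theorem relEntropy_add_lt {x y X Y : ℝ} (hx : 0 ≤ x) (hy : 0 ≤ y) (hX : 0 < X) (hY : 0 < Y)
    (hne : x * Y ≠ y * X) :
    relEntropy (x + y) (X + Y) < relEntropy x X + relEntropy y Y := by
  have hXY : 0 < X + Y := by positivity
  have hdiv : x / X ≠ y / Y := fun h => hne ((div_eq_div_iff hX.ne' hY.ne').1 h)
  have key := Real.strictConvexOn_mul_log.2 
    (Set.mem_Ici.2 (by positivity : 0 ≤ x / X)) (Set.mem_Ici.2 (by positivity : 0 ≤ y / Y)) hdiv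
    (by positivity : 0 < X / (X + Y)) (by positivity : 0 < Y / (X + Y)) (by field_simp)
  have hmid : X / (X + Y) * (x / X) + Y / (X + Y) * (y / Y) = (x + y) / (X + Y) := by
    field_simp
  simp only [smul_eq_mul] at key
  rw [hmid] at key
  rw [relEntropy_eq_mul hX, relEntropy_eq_mul hY, relEntropy_eq_mul hXY]
  calc _ < (X + Y) * (X / (X + Y) * (x / X * Real.log (x / X)) +
        Y / (X + Y) * (y / Y * Real.log (y / Y))) := by gcongr
    _ = _ := by field_simp

theorem relEntropy_add_eq {x y X Y : ℝ} (hX : 0 < X) (hY : 0 < Y) (h : x * Y = y * X) :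
    relEntropy (x + y) (X + Y) = relEntropy x X + relEntropy y Y := by
  have hXY : 0 < X + Y := by positivity
  have h1 : x / X = y / Y := (div_eq_div_iff hX.ne' hY.ne').2 h
  have h2 : (x + y) / (X + Y) = y / Y := by
    rw [div_eq_div_iff hXY.ne' hY.ne']
    linear_combination h
  rw [relEntropy_eq_mul hX, relEntropy_eq_mul hY, relEntropy_eq_mul hXY, h1, h2]
  ring

theorem relEntropy_add_le {x y X Y : ℝ} (hx : 0 ≤ x) (hy : 0 ≤ y) (hxX : x ≤ X) (hyY : y ≤ Y) :
    relEntropy (x + y) (X + Y) ≤ relEntropy x X + relEntropy y Y := by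
  rcases (hx.trans hxX).eq_or_lt with rfl | hX
  · obtain rfl : x = 0 := le_antisymm hxX hx
    simp [relEntropy]
  rcases (hy.trans hyY).eq_or_lt with rfl | hY
  · obtain rfl : y = 0 := le_antisymm hyY hy
    simp [relEntropy]
  by_cases h : x * Y = y * X
  · exact (relEntropy_add_eq hX hY h).le
  · exact (relEntropy_add_lt hx hy hX hY h).le

variable {A : Type*}

/-- The negative entropy of the normalisation of `w` on `S`, scaled by the total mass. -/
noncomputable def negEntropy (S : Finset A) (w : A → ℝ) : ℝ :=
  (∑ a ∈ S, w a * Real.log (w a)) - (∑ a ∈ S, w a) * Real.log (∑ a ∈ S, w a)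

theorem negEntropy_eq_sum (S : Finset A) (w : A → ℝ) :
    negEntropy S w = ∑ a ∈ S, relEntropy (w a) (∑ c ∈ S, w c) := by
  simp [negEntropy, relEntropy, Finset.sum_sub_distrib, Finset.sum_mul]

theorem continuous_negEntropy (S : Finset A) : Continuous (negEntropy S) := by
  have hsum : Continuous fun w : A → ℝ => ∑ a ∈ S, w a := by fun_prop
  exact (continuous_finsetSum _ fun a _ =>
    Real.continuous_mul_log.comp (continuous_apply a)).sub (Real.continuous_mul_log.comp hsum)

theorem negEntropy_smul (S : Finset A) {t : ℝ} (ht : 0 < t) {w : A → ℝ} (hw : ∀ a, 0 ≤ w a) :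
    negEntropy S (t • w) = t * negEntropy S w := by
  have hsum : ∑ a ∈ S, (t • w) a = t * ∑ a ∈ S, w a := (Finset.mul_sum _ _ _).symm
  rw [negEntropy_eq_sum, negEntropy_eq_sum, hsum]
  exact (Finset.sum_congr rfl fun a ha => relEntropy_smul ht (hw a)
    (Finset.single_le_sum (fun c _ => hw c) ha)).trans (Finset.mul_sum _ _ _).symm

theorem negEntropy_add_le (S : Finset A) {v w : A → ℝ} (hv : ∀ a, 0 ≤ v a) (hw : ∀ a, 0 ≤ w a) :
    negEntropy S (v + w) ≤ negEntropy S v + negEntropy S w := by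
  have hsum : ∑ a ∈ S, (v + w) a = ∑ a ∈ S, v a + ∑ a ∈ S, w a := Finset.sum_add_distrib
  rw [negEntropy_eq_sum, negEntropy_eq_sum, negEntropy_eq_sum, hsum]
  exact (Finset.sum_le_sum fun a ha => relEntropy_add_le (hv a) (hw a)
    (Finset.single_le_sum (fun c _ => hv c) ha)
    (Finset.single_le_sum (fun c _ => hw c) ha)).trans_eq Finset.sum_add_distrib

/-- Families of equal mass with additive negative entropy coincide. -/
theorem eq_of_negEntropy_add_eq {S : Finset A} {v w : A → ℝ} (hv : ∀ a, 0 ≤ v a)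
    (hw : ∀ a, 0 ≤ w a) (hmass : ∑ a ∈ S, v a = ∑ a ∈ S, w a)
    (h : negEntropy S (v + w) = negEntropy S v + negEntropy S w) :
    ∀ a ∈ S, v a = w a := by
  have hle (a) (ha : a ∈ S) := relEntropy_add_le (hv a) (hw a)
    (Finset.single_le_sum (fun c _ => hv c) ha) (Finset.single_le_sum (fun c _ => hw c) ha)
  have hsum : ∑ a ∈ S, (v + w) a = ∑ a ∈ S, v a + ∑ a ∈ S, w a := Finset.sum_add_distrib
  rw [negEntropy_eq_sum, negEntropy_eq_sum, negEntropy_eq_sum, hsum] at h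
  replace h := (Finset.sum_eq_sum_iff_of_le hle).1 (h.trans Finset.sum_add_distrib.symm)
  intro a ha
  rcases (Finset.sum_nonneg fun c (_ : c ∈ S) => hv c).eq_or_lt with h0 | hpos
  · rw [(Finset.sum_eq_zero_iff_of_nonneg fun c _ => hv c).1 h0.symm a ha,
      (Finset.sum_eq_zero_iff_of_nonneg fun c _ => hw c).1 (hmass ▸ h0.symm) a ha]
  · by_contra hne
    refine (relEntropy_add_lt (hv a) (hw a) hpos (hmass ▸ hpos) ?_).ne (h a ha)
    rw [hmass]
    exact fun heq => hne (mul_right_cancel₀ (hmass ▸ hpos).ne' heq)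

end Entropy

section Potential

theorem exists_potential {f : ℝ → ℝ} (hc : ContinuousOn f (Set.Ici 0))
    (hm : MonotoneOn f (Set.Ici 0)) (q : ℝ) :
    ∃ Φ : ℝ → ℝ, Continuous Φ ∧ ConvexOn ℝ Set.univ Φ ∧
      ∀ y, 0 ≤ y → ∫ u in (0 : ℝ)..y, (f u + q) = Φ y := by
  set g : ℝ → ℝ := fun u => f (max u 0) + q
  have hg : Continuous g :=
    (hc.comp_continuous (by fun_prop) fun u => le_max_right u 0).add continuous_const
  have hderiv (y : ℝ) : HasDerivAt (fun y => ∫ u in (0 : ℝ)..y, g u) (g y) y :=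
    hg.integral_hasStrictDerivAt 0 y |>.hasDerivAt
  refine ⟨fun y => ∫ u in (0 : ℝ)..y, g u,
    continuous_iff_continuousAt.2 fun y => (hderiv y).continuousAt, ?_, fun y hy => ?_⟩
  · refine Monotone.convexOn_univ_of_deriv (fun y => (hderiv y).differentiableAt) ?_
    intro x y hxy
    rw [(hderiv x).deriv, (hderiv y).deriv]
    exact add_le_add_left (hm (le_max_right x 0) (le_max_right y 0) (max_le_max_right 0 hxy)) q
  · refine intervalIntegral.integral_congr fun u hu => ?_
    rw [Set.uIcc_of_le hy] at hu
    simp [g, max_eq_left hu.1]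

end Potential

section Flows

variable {A I : Type*} [Fintype A] [DecidableEq I]

/-- The polytope of nonnegative flows of value `g` from `o` to `d`. -/
def flowPolytope (tail head : A → I) (o d : I) (g : ℝ) : Set (A → ℝ) :=
  {w : A → ℝ | (∀ a, 0 ≤ w a) ∧
    (∀ i, i ≠ o → i ≠ d →
      ∑ a ∈ univ.filter (fun a => tail a = i), w a =
      ∑ a ∈ univ.filter (fun a => head a = i), w a) ∧
    ∑ a ∈ univ.filter (fun a => tail a = o), w a = g}

variable {tail head : A → I} {o d : I} {g : ℝ}

theorem convex_flowPolytope : Convex ℝ (flowPolytope tail head o d g) := by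
  rintro v ⟨hv0, hv, hvo⟩ w ⟨hw0, hw, hwo⟩ s t hs ht hst
  refine ⟨fun a => ?_, fun i hio hid => ?_, ?_⟩
  · exact add_nonneg (mul_nonneg hs (hv0 a)) (mul_nonneg ht (hw0 a))
  · simp only [Pi.add_apply, Pi.smul_apply, smul_eq_mul, Finset.sum_add_distrib,
      ← Finset.mul_sum, hv i hio hid, hw i hio hid]
  · simp only [Pi.add_apply, Pi.smul_apply, smul_eq_mul, Finset.sum_add_distrib,
      ← Finset.mul_sum, hvo, hwo, ← add_mul, hst, one_mul]

theorem isClosed_flowPolytope : IsClosed (flowPolytope tail head o d g) := by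
  have hsum (S : Finset A) : Continuous fun w : A → ℝ => ∑ a ∈ S, w a := by fun_prop
  simp only [flowPolytope, Set.ofPred_and, Set.ofPred_forall]
  refine (isClosed_iInter fun a => isClosed_le continuous_const (continuous_apply a)).inter
    (IsClosed.inter ?_ (isClosed_eq (hsum _) continuous_const))
  exact isClosed_iInter fun i => isClosed_iInter fun _ => isClosed_iInter fun _ =>
    isClosed_eq (hsum _) (hsum _)

theorem nonempty_flowPolytope (hod : o ≠ d) (hg : 0 ≤ g) (h_in : ∀ a, head a ≠ o)
    {L : List A} (hL : IsWalk tail head L o d) : (flowPolytope tail head o d g).Nonempty := by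
  classical
  refine ⟨fun a => g * (L.count a : ℝ), fun a => by positivity, fun i hio hid => ?_, ?_⟩
  · have := IsWalk.sum_count hL i
    simp only [hio, hid, if_false, add_zero] at this
    rw [← Finset.mul_sum, ← Finset.mul_sum]
    exact_mod_cast congrArg (fun n : ℕ => g * (n : ℝ)) this
  · have := IsWalk.sum_count hL o
    simp only [hod, if_false, if_true, h_in, Finset.filter_false, Finset.sum_empty,
      add_zero, zero_add] at this
    rw [← Finset.mul_sum, ← Nat.cast_sum, this, Nat.cast_one, mul_one]

theorem isCompact_flowPolytope (hwf : WellFounded fun i j => ∃ a, tail a = i ∧ head a = j)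
    (h_out : ∀ a, tail a ≠ d) : IsCompact (flowPolytope tail head o d g) := by
  have hbound : ∀ i, ∃ C, ∀ w ∈ flowPolytope tail head o d g,
      ∑ a ∈ univ.filter (fun a => tail a = i), w a ≤ C := by
    intro i
    induction i using hwf.induction with
    | _ i ih =>
      by_cases hio : i = o
      · exact ⟨g, fun w hw => hio ▸ hw.2.2.le⟩
      by_cases hid : i = d
      · exact ⟨0, fun w _ => by simp [hid, h_out]⟩
      have harc : ∀ a, ∃ C, head a = i → ∀ w ∈ flowPolytope tail head o d g, w a ≤ C := by
        intro a
        by_cases ha : head a = i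
        · obtain ⟨C, hC⟩ := ih (tail a) ⟨a, rfl, ha⟩
          exact ⟨C, fun _ w hw =>
            (Finset.single_le_sum (fun c _ => hw.1 c) (by simp)).trans (hC w hw)⟩
        · exact ⟨0, fun h => absurd h ha⟩
      choose C hC using harc
      refine ⟨∑ a ∈ univ.filter (fun a => head a = i), C a, fun w hw => ?_⟩
      rw [hw.2.1 i hio hid]
      exact Finset.sum_le_sum fun a ha => hC a (Finset.mem_filter.1 ha).2 w hw
  choose C hC using hbound
  refine (isCompact_Icc (a := (0 : A → ℝ)) (b := fun a => C (tail a))).of_isClosed_subset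
    isClosed_flowPolytope fun w hw => ⟨hw.1, fun a => ?_⟩
  exact (Finset.single_le_sum (f := w) (fun c _ => hw.1 c) (by simp)).trans (hC (tail a) w hw)

/-- Flows of equal value whose negative entropies are additive at every node coincide. -/
theorem eq_of_forall_negEntropy_add_eq
    (hwf : WellFounded fun i j => ∃ a, tail a = i ∧ head a = j) (h_out : ∀ a, tail a ≠ d)
    {v w : A → ℝ} (hv : v ∈ flowPolytope tail head o d g)
    (hw : w ∈ flowPolytope tail head o d g)
    (h : ∀ i, i ≠ d → negEntropy (univ.filter fun a => tail a = i) (v + w) =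
      negEntropy (univ.filter fun a => tail a = i) v +
        negEntropy (univ.filter fun a => tail a = i) w) :
    v = w := by
  have hnode : ∀ i, ∀ a, tail a = i → v a = w a := by
    intro i
    induction i using hwf.induction with
    | _ i ih =>
      by_cases hid : i = d
      · exact fun a ha => absurd (ha.trans hid) (h_out a)
      have hmass : ∑ a ∈ univ.filter (fun a => tail a = i), v a =
          ∑ a ∈ univ.filter (fun a => tail a = i), w a := by
        by_cases hio : i = o
        · rw [hio, hv.2.2, hw.2.2]
        · rw [hv.2.1 i hio hid, hw.2.1 i hio hid]
          exact Finset.sum_congr rfl fun a ha =>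
            ih (tail a) ⟨a, rfl, (Finset.mem_filter.1 ha).2⟩ a rfl
      intro a ha
      exact eq_of_negEntropy_add_eq hv.1 hw.1 hmass (h i hid) a (by simp [ha])
  exact funext fun a => hnode _ a rfl

end Flows

end CoDAG

/-- Existence and uniqueness of the CoDAG equilibrium: for each fixed toll vector `p`,
the function `F (·, p)` attains its minimum over the flow polytope `W` at exactly one point. -/
theorem codag_equilibrium_exists_unique
    {A_O A I : Type*} [Fintype A_O] [Fintype A] [Fintype I]
    [Nonempty A_O] [Nonempty A]
    [DecidableEq A_O] [DecidableEq A] [DecidableEq I]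
    (π : A → A_O) (tail head : A → I) (o d : I) (hod : o ≠ d)
    (g_o : ℝ) (hg : 0 < g_o)
    (s : A_O → ℝ → ℝ)
    (hs_cont : ∀ b, ContinuousOn (s b) (Set.Ici 0))
    (hs_pos : ∀ b, ∀ x ∈ Set.Ici (0 : ℝ), 0 < s b x)
    (hs_mono : ∀ b, StrictMonoOn (s b) (Set.Ici 0))
    (β : ℝ) (hβ : 0 < β)
    (W : Set (A → ℝ))
    (hW : W = {w : A → ℝ | (∀ a, 0 ≤ w a) ∧
      (∀ i, i ≠ o → i ≠ d →
        ∑ a ∈ univ.filter (fun a => tail a = i), w a =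
        ∑ a ∈ univ.filter (fun a => head a = i), w a) ∧
      ∑ a ∈ univ.filter (fun a => tail a = o), w a = g_o})
    (F : (A → ℝ) → (A_O → ℝ) → ℝ)
    (hF : F = fun w p =>
      (∑ b : A_O,
        ∫ u in (0 : ℝ)..(∑ a ∈ univ.filter (fun a => π a = b), w a), (s b u + p b)) +
      (1 / β) * ∑ i ∈ univ.filter (fun i => i ≠ d),
        ((∑ a ∈ univ.filter (fun a => tail a = i), w a * Real.log (w a)) -
         (∑ a ∈ univ.filter (fun a => tail a = i), w a) *
           Real.log (∑ a ∈ univ.filter (fun a => tail a = i), w a)))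
    -- CoDAG hypotheses:
    (h_acyclic : ∀ (L : List A) (i : I), L ≠ [] → ¬ IsWalk tail head L i i)
    (h_no_arc_into_o : ∀ a, head a ≠ o)
    (h_no_arc_out_of_d : ∀ a, tail a ≠ d)
    (h_arc_on_path : ∀ a : A, ∃ L : List A, IsWalk tail head L o d ∧ a ∈ L)
    (h_path : ∃ L : List A, IsWalk tail head L o d)
    (p : A_O → ℝ) :
    ∃! wbar : A → ℝ, wbar ∈ W ∧ ∀ w ∈ W, F wbar p ≤ F w p := by
  have hwf := CoDAG.wellFounded_arc h_acyclic
  change W = CoDAG.flowPolytope tail head o d g_o at hW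
  subst hW
  obtain ⟨L, hL⟩ := h_path
  choose Φ hΦ_cont hΦ_conv hΦ using fun b =>
    CoDAG.exists_potential (hs_cont b) (hs_mono b).monotoneOn (p b)
  set G : (A → ℝ) → ℝ := fun w => ∑ b : A_O, Φ b (∑ a ∈ univ.filter (fun a => π a = b), w a)
  set H : (A → ℝ) → ℝ := fun w => ∑ i ∈ univ.filter (fun i => i ≠ d),
    CoDAG.negEntropy (univ.filter fun a => tail a = i) w
  have hFGH (w) (hw : w ∈ CoDAG.flowPolytope tail head o d g_o) :
      F w p = G w + (1 / β) * H w := by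
    subst hF
    exact congrArg (· + (1 / β) * H w)
      (Finset.sum_congr rfl fun b _ => hΦ b _ (Finset.sum_nonneg fun a _ => hw.1 a))
  have hG_cont : Continuous G := continuous_finsetSum _ fun b _ =>
    (hΦ_cont b).comp (continuous_finsetSum _ fun a _ => continuous_apply a)
  have hH_cont : Continuous H := continuous_finsetSum _ fun i _ => CoDAG.continuous_negEntropy _
  obtain ⟨v, hv, hmin⟩ := (CoDAG.isCompact_flowPolytope (o := o) (g := g_o) hwf
    h_no_arc_out_of_d).exists_isMinOn
    (CoDAG.nonempty_flowPolytope hod hg.le h_no_arc_into_o hL)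
    (f := fun w => G w + (1 / β) * H w)
    (hG_cont.add (continuous_const.mul hH_cont)).continuousOn
  have hv_min (w) (hw : w ∈ CoDAG.flowPolytope tail head o d g_o) : F v p ≤ F w p := by
    rw [hFGH v hv, hFGH w hw]
    exact hmin hw
  refine ⟨v, ⟨hv, hv_min⟩, fun w ⟨hw, hw_min⟩ => ?_⟩
  have hm : (2⁻¹ : ℝ) • w + (2⁻¹ : ℝ) • v ∈ CoDAG.flowPolytope tail head o d g_o :=
    CoDAG.convex_flowPolytope hw hv (by norm_num) (by norm_num) (by norm_num)
  have hG_mid : G ((2⁻¹ : ℝ) • w + (2⁻¹ : ℝ) • v) ≤ 2⁻¹ * G w + 2⁻¹ * G v := by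
    simp only [G, Finset.mul_sum, ← Finset.sum_add_distrib]
    refine Finset.sum_le_sum fun b _ => ?_
    simpa [Finset.sum_add_distrib, ← Finset.mul_sum] using
      (hΦ_conv b).2 (Set.mem_univ (∑ a ∈ univ.filter (fun a => π a = b), w a))
        (Set.mem_univ (∑ a ∈ univ.filter (fun a => π a = b), v a))
        (by norm_num : (0 : ℝ) ≤ 2⁻¹) (by norm_num : (0 : ℝ) ≤ 2⁻¹) (by norm_num)
  have hF_mid : 2⁻¹ * F w p + 2⁻¹ * F v p ≤ F ((2⁻¹ : ℝ) • w + (2⁻¹ : ℝ) • v) p := by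
    linarith [hw_min _ hm, hv_min _ hm]
  rw [hFGH w hw, hFGH v hv, hFGH _ hm] at hF_mid
  have hH_mid : H w + H v ≤ H (w + v) := by
    have hscale : H ((2⁻¹ : ℝ) • w + (2⁻¹ : ℝ) • v) = 2⁻¹ * H (w + v) := by
      simp only [H, Finset.mul_sum, ← smul_add]
      exact Finset.sum_congr rfl fun i _ =>
        CoDAG.negEntropy_smul _ (by norm_num) fun a => add_nonneg (hw.1 a) (hv.1 a)
    rw [hscale] at hF_mid
    have hβ' : 0 < 1 / β := by positivity
    refine le_of_mul_le_mul_left ?_ hβ'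
    linarith
  have hle (i) (_ : i ∈ univ.filter (fun i => i ≠ d)) :=
    CoDAG.negEntropy_add_le (univ.filter fun a => tail a = i) hw.1 hv.1
  have heq := (Finset.sum_eq_sum_iff_of_le hle).1
    (le_antisymm (Finset.sum_le_sum hle) (by rwa [Finset.sum_add_distrib]))
  exact CoDAG.eq_of_forall_negEntropy_add_eq hwf h_no_arc_out_of_d hw hv
    fun i hi => heq i (by simpa using hi)
end

section
/- (Monotonicity of the CoDAG equilibrium in the tolls.) For all toll vectors p, p' ∈ ℝ^{A_O}: ∑_{a ∈ A} ( w̄(p')_a − w̄(p)_a ) · ( p'_{π(a)} − p_{π(a)} ) ≤ 0; equivalently, in aggregated form, ∑_{b ∈ A_O} ( w̄(p')_b − w̄(p)_b ) · ( p'_b − p_b ) ≤ 0, where w̄(p)_b := ∑_{a : π(a) = b} w̄(p)_a. -/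
open Finset

/-- A constant toll enters the integrated latency linearly in the flow. -/
lemma integral_latency_add_toll {f : ℝ → ℝ} (hf : ContinuousOn f (Set.Ici 0)) {x : ℝ}
    (hx : 0 ≤ x) (c : ℝ) :
    ∫ u in (0 : ℝ)..x, (f u + c) = (∫ u in (0 : ℝ)..x, f u) + x * c := by
  have hfi : IntervalIntegrable f MeasureTheory.volume 0 x := by
    refine (hf.mono fun y hy => ?_).intervalIntegrable
    rw [Set.uIcc_of_le hx] at hy
    exact hy.1
  rw [intervalIntegral.integral_add hfi intervalIntegrable_const]
  simp

/-- Monotonicity of the CoDAG equilibrium in the tolls. -/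
theorem codag_equilibrium_monotone_in_tolls
    {A_O A I : Type*} [Fintype A_O] [Fintype A] [Fintype I]
    [Nonempty A_O] [Nonempty A]
    [DecidableEq A_O] [DecidableEq A] [DecidableEq I]
    (π : A → A_O) (tail head : A → I) (o d : I) (hod : o ≠ d)
    (g_o : ℝ) (hg : 0 < g_o)
    (s : A_O → ℝ → ℝ)
    (hs_cont : ∀ b, ContinuousOn (s b) (Set.Ici 0))
    (hs_pos : ∀ b, ∀ x ∈ Set.Ici (0 : ℝ), 0 < s b x)
    (hs_mono : ∀ b, StrictMonoOn (s b) (Set.Ici 0))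
    (β : ℝ) (hβ : 0 < β)
    (W : Set (A → ℝ))
    (hW : W = {w : A → ℝ | (∀ a, 0 ≤ w a) ∧
      (∀ i, i ≠ o → i ≠ d →
        ∑ a ∈ univ.filter (fun a => tail a = i), w a =
        ∑ a ∈ univ.filter (fun a => head a = i), w a) ∧
      ∑ a ∈ univ.filter (fun a => tail a = o), w a = g_o})
    (F : (A → ℝ) → (A_O → ℝ) → ℝ)
    (hF : F = fun w p =>
      (∑ b : A_O,
        ∫ u in (0 : ℝ)..(∑ a ∈ univ.filter (fun a => π a = b), w a), (s b u + p b)) +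
      (1 / β) * ∑ i ∈ univ.filter (fun i => i ≠ d),
        ((∑ a ∈ univ.filter (fun a => tail a = i), w a * Real.log (w a)) -
         (∑ a ∈ univ.filter (fun a => tail a = i), w a) *
           Real.log (∑ a ∈ univ.filter (fun a => tail a = i), w a)))
    (wbar : (A_O → ℝ) → (A → ℝ))
    (h_mem : ∀ p, wbar p ∈ W)
    (h_min : ∀ p, ∀ w ∈ W, F (wbar p) p ≤ F w p)
    (h_unique : ∀ p, ∀ w ∈ W, (∀ w' ∈ W, F w p ≤ F w' p) → w = wbar p)
    (h_pos : ∀ p a, 0 < wbar p a) :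
    ∀ p p' : A_O → ℝ,
      (∑ a : A, (wbar p' a - wbar p a) * (p' (π a) - p (π a)) ≤ 0) ∧
      (∑ b : A_O,
        ((∑ a ∈ univ.filter (fun a => π a = b), wbar p' a) -
         (∑ a ∈ univ.filter (fun a => π a = b), wbar p a)) * (p' b - p b) ≤ 0) := by
  intro p p'
  have hagg : ∑ b : A_O, ((∑ a ∈ univ.filter (fun a => π a = b), wbar p' a) -
      (∑ a ∈ univ.filter (fun a => π a = b), wbar p a)) * (p' b - p b) ≤ 0 := by
    have hF_diff : ∀ q, F (wbar q) p' - F (wbar q) p =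
        ∑ b : A_O, (∑ a ∈ univ.filter (fun a => π a = b), wbar q a) * (p' b - p b) := by
      intro q
      have hint := fun (b : A_O) (c : ℝ) => integral_latency_add_toll (hs_cont b)
        (sum_nonneg fun a (_ : a ∈ univ.filter (fun a => π a = b)) => (h_pos q a).le) c
      simp only [hF, hint, sum_add_distrib, mul_sub, sum_sub_distrib]
      ring
    have h₁ := h_min p (wbar p') (h_mem p')
    have h₂ := h_min p' (wbar p) (h_mem p)
    have h₃ := hF_diff p
    have h₄ := hF_diff p'
    simp only [sub_mul _ _ (p' _ - p _), sum_sub_distrib]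
    linarith
  refine ⟨?_, hagg⟩
  convert hagg using 1
  rw [← sum_fiberwise univ π]
  refine sum_congr rfl fun b _ => ?_
  rw [← sum_sub_distrib, sum_mul]
  refine sum_congr rfl fun a ha => ?_
  rw [(mem_filter.mp ha).2]
end

section
/- (Continuous differentiability of the CoDAG equilibrium in the tolls.) The map p ↦ w̄(p), from ℝ^{A_O} to ℝ^A, is continuously differentiable. -/
open Finset

open scoped Topology

/-- If a parametrized field of linear forms `D p` has positive definite derivative on a convex open
set `U`, then a family of zeros of `D p` restricted to a fixed subspace, lying in `U` and in a
fixed translate of that subspace, depends on the parameter in a `C¹` way. -/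
theorem contDiff_of_stationary_of_fderiv_pos {E P : Type*}
    [NormedAddCommGroup E] [NormedSpace ℝ E] [FiniteDimensional ℝ E]
    [NormedAddCommGroup P] [NormedSpace ℝ P] [CompleteSpace P]
    (V : Submodule ℝ E) {U : Set E} (hUo : IsOpen U) (hUc : Convex ℝ U)
    (D : P → E → E →L[ℝ] ℝ)
    (hD : ∀ p, ∀ w ∈ U, ContDiffAt ℝ 1 (fun x : P × E => D x.1 x.2) (p, w))
    (hpos : ∀ p, ∀ w ∈ U, ∀ v, v ≠ 0 → 0 < fderiv ℝ (D p) w v v)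
    (w : P → E) (hwU : ∀ p, w p ∈ U) (hwV : ∀ p q, w p - w q ∈ V)
    (hstat : ∀ p, ∀ v ∈ V, D p (w p) v = 0) : ContDiff ℝ 1 w := by
  have hDdiff : ∀ p, ∀ x ∈ U, HasFDerivAt (D p) (fderiv ℝ (D p) x) x := by
    intro p x hx
    have h1 : ContDiffAt ℝ 1 (fun y : E => D p y) x :=
      (hD p x hx).comp x (contDiffAt_const.prodMk contDiffAt_id)
    exact (h1.differentiableAt one_ne_zero).hasFDerivAt
  have huniq : ∀ p, ∀ x ∈ U, ∀ y ∈ U, y - x ∈ V → (∀ v ∈ V, D p x v = 0) →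
      (∀ v ∈ V, D p y v = 0) → x = y := by
    intro p x hx y hy hxy hx0 hy0
    by_contra hne
    have hseg : ∀ t ∈ Set.Icc (0 : ℝ) 1, x + t • (y - x) ∈ U := fun t ht =>
      hUc.add_smul_sub_mem hx hy ht
    have hder : ∀ t ∈ Set.Icc (0 : ℝ) 1,
        HasDerivAt (fun t : ℝ => D p (x + t • (y - x)) (y - x))
          (fderiv ℝ (D p) (x + t • (y - x)) (y - x) (y - x)) t := by
      intro t ht
      have h1 : HasDerivAt (fun t : ℝ => x + t • (y - x)) (y - x) t := by
        simpa using ((hasDerivAt_id t).smul_const (y - x)).const_add x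
      have h2 := (hDdiff p _ (hseg t ht)).comp_hasDerivAt t h1
      simpa using h2.clm_apply (hasDerivAt_const t (y - x))
    obtain ⟨c, hc, hc0⟩ := exists_hasDerivAt_eq_zero zero_lt_one
      (fun t ht => (hder t ht).continuousAt.continuousWithinAt)
      (by simp [hx0 _ hxy, hy0 _ hxy])
      (fun t ht => hder t (Set.Ioo_subset_Icc_self ht))
    exact (hpos p _ (hseg c (Set.Ioo_subset_Icc_self hc)) (y - x)
      (sub_ne_zero.mpr (Ne.symm hne))).ne' hc0
  rw [contDiff_iff_contDiffAt]
  intro p₀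
  let R := (ContinuousLinearMap.compL ℝ V E ℝ).flip V.subtypeL
  let Φ : P × V → (V →L[ℝ] ℝ) := fun x => R (D x.1 (w p₀ + x.2))
  have hΦ : ContDiffAt ℝ 1 Φ (p₀, 0) := by
    have h1 : ContDiffAt ℝ 1 (fun x : P × V => (x.1, w p₀ + (x.2 : E))) (p₀, 0) :=
      contDiffAt_fst.prodMk
        (contDiffAt_const.add (V.subtypeL.contDiff.contDiffAt.comp _ contDiffAt_snd))
    have h2 : ContDiffAt ℝ 1 (fun x : P × E => D x.1 x.2) (p₀, w p₀ + ((0 : V) : E)) := by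
      simpa using hD p₀ _ (hwU p₀)
    have hR : ContDiff ℝ 1 R := R.contDiff
    have h3 : ContDiffAt ℝ 1 (fun x : P × V => D x.1 (w p₀ + x.2)) (p₀, 0) :=
      ContDiffAt.comp (g := fun x : P × E => D x.1 x.2) (p₀, (0 : V)) h2 h1
    exact hR.contDiffAt.comp _ h3
  have hpart : ∀ v u : V, (fderiv ℝ Φ (p₀, 0) ∘L .inr ℝ P V) v u =
      fderiv ℝ (D p₀) (w p₀) v u := by
    intro v u
    have h1 : HasFDerivAt (fun v : V => Φ (p₀, v)) (fderiv ℝ Φ (p₀, 0) ∘L .inr ℝ P V) 0 :=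
      (hΦ.differentiableAt one_ne_zero).hasFDerivAt.comp (0 : V) (hasFDerivAt_prodMk_right p₀ 0)
    have h2 : HasFDerivAt (fun v : V => w p₀ + (v : E)) V.subtypeL 0 :=
      V.subtypeL.hasFDerivAt.const_add _
    have h3 : HasFDerivAt (D p₀) (fderiv ℝ (D p₀) (w p₀)) (w p₀ + ((0 : V) : E)) := by
      simpa using hDdiff p₀ _ (hwU p₀)
    have h4 : HasFDerivAt (fun v : V => Φ (p₀, v))
        (R ∘L (fderiv ℝ (D p₀) (w p₀) ∘L V.subtypeL)) 0 :=
      HasFDerivAt.comp (g := R) (f := fun v : V => D p₀ (w p₀ + v)) (0 : V) R.hasFDerivAt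
        (h3.comp (0 : V) h2)
    rw [h1.unique h4]
    rfl
  have hinv : (fderiv ℝ Φ (p₀, 0) ∘L .inr ℝ P V).IsInvertible := by
    set B := fderiv ℝ Φ (p₀, 0) ∘L .inr ℝ P V
    have hinj : Function.Injective B.toLinearMap := by
      rw [← LinearMap.ker_eq_bot, LinearMap.ker_eq_bot']
      intro v hv
      by_contra hne
      have h1 := hpos p₀ _ (hwU p₀) v (by simpa using hne)
      rw [← hpart v v] at h1
      have : B v = 0 := hv
      simp [B, this] at h1
    have hdim : Module.finrank ℝ V = Module.finrank ℝ (V →L[ℝ] ℝ) := by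
      rw [← LinearMap.toContinuousLinearMap.finrank_eq]
      exact Subspace.dual_finrank_eq.symm
    refine ⟨(B.toLinearMap.linearEquivOfInjective hinj hdim).toContinuousLinearEquiv, ?_⟩
    ext v : 1
    rfl
  let ψ := hΦ.implicitFunction one_ne_zero hinv
  have hψ : ContDiffAt ℝ 1 ψ p₀ := hΦ.contDiffAt_implicitFunction one_ne_zero hinv
  have hψ0 : ψ p₀ = 0 := hΦ.implicitFunction_apply_self one_ne_zero hinv
  have hΦ0 : Φ (p₀, 0) = 0 := by
    ext v
    simpa [Φ, R] using hstat p₀ v v.2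
  have hψcont : ContDiffAt ℝ 1 (fun p => w p₀ + (ψ p : E)) p₀ :=
    contDiffAt_const.add (V.subtypeL.contDiff.contDiffAt.comp _ hψ)
  have hU : ∀ᶠ p in 𝓝 p₀, w p₀ + (ψ p : E) ∈ U := by
    apply hψcont.continuousAt.eventually_mem
    simpa [hψ0] using hUo.mem_nhds (hwU p₀)
  refine hψcont.congr_of_eventuallyEq ?_
  filter_upwards [hU, hΦ.eventually_apply_implicitFunction one_ne_zero hinv] with p hpU hp
  refine huniq p _ (hwU p) _ hpU ?_ (hstat p) ?_
  · have := V.add_mem (hwV p₀ p) (ψ p).2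
    rwa [show w p₀ + (ψ p : E) - w p = w p₀ - w p + ψ p by abel]
  · intro v hv
    have h1 : Φ (p, ψ p) = 0 := hp.trans hΦ0
    exact DFunLike.congr_fun h1 (⟨v, hv⟩ : V)

section CoDAG

variable {A_O A I : Type*} [Fintype A_O] [Fintype A] [Fintype I]
  [DecidableEq A_O] [DecidableEq I]

/-- The gradient in `w`, as a linear form, of the toll-perturbed CoDAG objective. -/
noncomputable def codagGradient (π : A → A_O) (tail : A → I) (d : I) (s : A_O → ℝ → ℝ) (β : ℝ)
    (p : A_O → ℝ) (w : A → ℝ) : (A → ℝ) →L[ℝ] ℝ :=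
  (∑ b : A_O, (s b (∑ a ∈ univ.filter (fun a => π a = b), w a) + p b) •
    ∑ a ∈ univ.filter (fun a => π a = b), ContinuousLinearMap.proj (R := ℝ) a) +
  (1 / β) • ∑ i ∈ univ.filter (fun i => i ≠ d), ∑ a ∈ univ.filter (fun a => tail a = i),
    (Real.log (w a) - Real.log (∑ a ∈ univ.filter (fun a => tail a = i), w a)) •
      ContinuousLinearMap.proj (R := ℝ) a

/-- A sum of coordinates is differentiable, with the sum of coordinate projections as derivative. -/
theorem hasFDerivAt_sum_coord (T : Finset A) (w : A → ℝ) :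
    HasFDerivAt (fun w : A → ℝ => ∑ a ∈ T, w a)
      (∑ a ∈ T, ContinuousLinearMap.proj (R := ℝ) (φ := fun _ : A => ℝ) a) w :=
  HasFDerivAt.fun_sum fun a _ => hasFDerivAt_apply a w

theorem hasFDerivAt_entropy_sum (T : Finset A) {w : A → ℝ} (hw : ∀ a, 0 < w a) :
    HasFDerivAt (fun w : A → ℝ => (∑ a ∈ T, w a * Real.log (w a)) -
        (∑ a ∈ T, w a) * Real.log (∑ a ∈ T, w a))
      (∑ a ∈ T, (Real.log (w a) - Real.log (∑ a ∈ T, w a)) •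
        ContinuousLinearMap.proj (R := ℝ) (φ := fun _ : A => ℝ) a) w := by
  rcases T.eq_empty_or_nonempty with rfl | hT
  · simpa using hasFDerivAt_const (0 : ℝ) w
  have hS : 0 < ∑ a ∈ T, w a := sum_pos (fun a _ => hw a) hT
  have h1 : HasFDerivAt (fun w : A → ℝ => ∑ a ∈ T, w a * Real.log (w a))
      (∑ a ∈ T, (Real.log (w a) + 1) •
        ContinuousLinearMap.proj (R := ℝ) (φ := fun _ : A => ℝ) a) w :=
    HasFDerivAt.fun_sum fun a _ =>
      HasDerivAt.comp_hasFDerivAt (f := fun w : A → ℝ => w a) w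
        (Real.hasDerivAt_mul_log (hw a).ne') (hasFDerivAt_apply a w)
  have h2 := (Real.hasDerivAt_mul_log hS.ne').comp_hasFDerivAt w (hasFDerivAt_sum_coord T w)
  refine (h1.sub h2).congr_fderiv ?_
  rw [smul_sum, ← sum_sub_distrib]
  refine sum_congr rfl fun a _ => ?_
  rw [← sub_smul]
  ring_nf

theorem hasFDerivAt_latency_integral {f : ℝ → ℝ} (hf : ContinuousOn f (Set.Ici 0)) (T : Finset A)
    {w : A → ℝ} (hw : ∀ a, 0 < w a) :
    HasFDerivAt (fun w : A → ℝ => ∫ u in (0 : ℝ)..(∑ a ∈ T, w a), f u)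
      (f (∑ a ∈ T, w a) • ∑ a ∈ T, ContinuousLinearMap.proj (R := ℝ) (φ := fun _ : A => ℝ) a)
      w := by
  rcases T.eq_empty_or_nonempty with rfl | hT
  · simpa using hasFDerivAt_const (0 : ℝ) w
  have hS : 0 < ∑ a ∈ T, w a := sum_pos (fun a _ => hw a) hT
  have hint : IntervalIntegrable f MeasureTheory.volume 0 (∑ a ∈ T, w a) := by
    refine (hf.mono fun x hx => ?_).intervalIntegrable
    rw [Set.uIcc_of_le hS.le] at hx
    exact hx.1
  exact (intervalIntegral.integral_hasDerivAt_right hint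
    ((hf.mono Set.Ioi_subset_Ici_self).stronglyMeasurableAtFilter isOpen_Ioi _ hS)
    (hf.continuousAt (Ici_mem_nhds hS))).comp_hasFDerivAt w (hasFDerivAt_sum_coord T w)

theorem hasFDerivAt_codag_objective (π : A → A_O) (tail : A → I) (d : I) {s : A_O → ℝ → ℝ}
    (hs : ∀ b, ContinuousOn (s b) (Set.Ici 0)) (β : ℝ) (p : A_O → ℝ) {w : A → ℝ}
    (hw : ∀ a, 0 < w a) :
    HasFDerivAt (fun w : A → ℝ => (∑ b : A_O,
        ∫ u in (0 : ℝ)..(∑ a ∈ univ.filter (fun a => π a = b), w a), (s b u + p b)) +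
      (1 / β) * ∑ i ∈ univ.filter (fun i => i ≠ d),
        ((∑ a ∈ univ.filter (fun a => tail a = i), w a * Real.log (w a)) -
         (∑ a ∈ univ.filter (fun a => tail a = i), w a) *
           Real.log (∑ a ∈ univ.filter (fun a => tail a = i), w a)))
      (codagGradient π tail d s β p w) w :=
  (HasFDerivAt.fun_sum fun b _ => hasFDerivAt_latency_integral
    ((hs b).add continuousOn_const) _ hw).add
    ((HasFDerivAt.fun_sum fun _ _ => hasFDerivAt_entropy_sum _ hw).const_mul (1 / β))

theorem contDiffAt_codagGradient (π : A → A_O) (tail : A → I) (d : I) {s : A_O → ℝ → ℝ}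
    (hs : ∀ b, ContDiffOn ℝ 1 (s b) (Set.Ici 0)) (β : ℝ) (p : A_O → ℝ) {w : A → ℝ}
    (hw : ∀ a, 0 < w a) :
    ContDiffAt ℝ 1 (fun x : (A_O → ℝ) × (A → ℝ) => codagGradient π tail d s β x.1 x.2) (p, w) := by
  have hcoord : ∀ a : A, ContDiffAt ℝ 1 (fun x : (A_O → ℝ) × (A → ℝ) => x.2 a) (p, w) :=
    fun a => by fun_prop
  have hsum : ∀ T : Finset A,
      ContDiffAt ℝ 1 (fun x : (A_O → ℝ) × (A → ℝ) => ∑ a ∈ T, x.2 a) (p, w) :=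
    fun T => ContDiffAt.sum fun a _ => hcoord a
  refine ContDiffAt.add (ContDiffAt.sum fun b _ => ?_)
    (ContDiffAt.const_smul (1 / β) (ContDiffAt.sum fun i _ => ContDiffAt.sum fun a ha => ?_))
  · rcases (univ.filter (fun a => π a = b)).eq_empty_or_nonempty with hT | hT
    · simpa [hT] using contDiffAt_const
    · have hS : 0 < ∑ a ∈ univ.filter (fun a => π a = b), w a := sum_pos (fun a _ => hw a) hT
      have h1 : ContDiffAt ℝ 1 (s b) (∑ a ∈ univ.filter (fun a => π a = b), w a) :=
        (hs b).contDiffAt (Ici_mem_nhds hS)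
      have h2 : ContDiffAt ℝ 1 (fun x : (A_O → ℝ) × (A → ℝ) => x.1 b) (p, w) := by fun_prop
      exact ((h1.comp (p, w) (hsum _)).add h2).smul contDiffAt_const
  · have hS : 0 < ∑ a ∈ univ.filter (fun a => tail a = i), w a :=
      sum_pos (fun a _ => hw a) ⟨a, ha⟩
    exact (((hcoord a).log (hw a).ne').sub ((hsum _).log hS.ne')).smul contDiffAt_const

/-- The directions that preserve flow conservation and the demand at the origin. -/
def codagDirections (tail head : A → I) (o d : I) : Submodule ℝ (A → ℝ) where
  carrier := {v | (∀ i, i ≠ o → i ≠ d →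
      ∑ a ∈ univ.filter (fun a => tail a = i), v a =
      ∑ a ∈ univ.filter (fun a => head a = i), v a) ∧
    ∑ a ∈ univ.filter (fun a => tail a = o), v a = 0}
  zero_mem' := by simp
  add_mem' := by
    rintro u v ⟨hu, hu0⟩ ⟨hv, hv0⟩
    refine ⟨fun i ho hd => ?_, ?_⟩
    · simp only [Pi.add_apply, sum_add_distrib, hu i ho hd, hv i ho hd]
    · simp only [Pi.add_apply, sum_add_distrib, hu0, hv0, add_zero]
  smul_mem' := by
    rintro c v ⟨hv, hv0⟩
    refine ⟨fun i ho hd => ?_, ?_⟩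
    · simp only [Pi.smul_apply, ← smul_sum, hv i ho hd]
    · simp only [Pi.smul_apply, ← smul_sum, hv0, smul_zero]

end CoDAG

/-- Continuous differentiability of the CoDAG equilibrium in the tolls. -/
theorem codag_equilibrium_contDiff_in_tolls
    {A_O A I : Type*} [Fintype A_O] [Fintype A] [Fintype I]
    [Nonempty A_O] [Nonempty A]
    [DecidableEq A_O] [DecidableEq A] [DecidableEq I]
    (π : A → A_O) (tail head : A → I) (o d : I) (hod : o ≠ d)
    (g_o : ℝ) (hg : 0 < g_o)
    (s : A_O → ℝ → ℝ)
    (hs_cont : ∀ b, ContinuousOn (s b) (Set.Ici 0))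
    (hs_pos : ∀ b, ∀ x ∈ Set.Ici (0 : ℝ), 0 < s b x)
    (hs_mono : ∀ b, StrictMonoOn (s b) (Set.Ici 0))
    (hs_contDiff : ∀ b, ContDiffOn ℝ 1 (s b) (Set.Ici 0))
    (β : ℝ) (hβ : 0 < β)
    (W : Set (A → ℝ))
    (hW : W = {w : A → ℝ | (∀ a, 0 ≤ w a) ∧
      (∀ i, i ≠ o → i ≠ d →
        ∑ a ∈ univ.filter (fun a => tail a = i), w a =
        ∑ a ∈ univ.filter (fun a => head a = i), w a) ∧
      ∑ a ∈ univ.filter (fun a => tail a = o), w a = g_o})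
    (F : (A → ℝ) → (A_O → ℝ) → ℝ)
    (hF : F = fun w p =>
      (∑ b : A_O,
        ∫ u in (0 : ℝ)..(∑ a ∈ univ.filter (fun a => π a = b), w a), (s b u + p b)) +
      (1 / β) * ∑ i ∈ univ.filter (fun i => i ≠ d),
        ((∑ a ∈ univ.filter (fun a => tail a = i), w a * Real.log (w a)) -
         (∑ a ∈ univ.filter (fun a => tail a = i), w a) *
           Real.log (∑ a ∈ univ.filter (fun a => tail a = i), w a)))
    -- positive definiteness of the Hessian of F(·, p) on the open positive orthant
    (h_hess : ∀ (p : A_O → ℝ) (w : A → ℝ), (∀ a, 0 < w a) →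
      ∀ v : A → ℝ, v ≠ 0 →
        0 < fderiv ℝ (fun w' => fderiv ℝ (fun w'' => F w'' p) w' v) w v)
    (wbar : (A_O → ℝ) → (A → ℝ))
    (h_mem : ∀ p, wbar p ∈ W)
    (h_min : ∀ p, ∀ w ∈ W, F (wbar p) p ≤ F w p)
    (h_unique : ∀ p, ∀ w ∈ W, (∀ w' ∈ W, F w p ≤ F w' p) → w = wbar p)
    (h_pos : ∀ p a, 0 < wbar p a) :
    ContDiff ℝ 1 wbar := by
  have hgrad : ∀ p w, (∀ a, 0 < w a) →
      HasFDerivAt (fun w => F w p) (codagGradient π tail d s β p w) w := by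
    intro p w hw
    rw [hF]
    exact hasFDerivAt_codag_objective π tail d hs_cont β p hw
  have hsub : ∀ p q, wbar p - wbar q ∈ codagDirections tail head o d := by
    intro p q
    have hp := h_mem p
    have hq := h_mem q
    rw [hW] at hp hq
    refine ⟨fun i ho hd => ?_, ?_⟩
    · simp only [Pi.sub_apply, sum_sub_distrib, hp.2.1 i ho hd, hq.2.1 i ho hd]
    · simp only [Pi.sub_apply, sum_sub_distrib, hp.2.2, hq.2.2, sub_self]
  have hU : {w : A → ℝ | ∀ a, 0 < w a} = Set.univ.pi fun _ => Set.Ioi 0 := by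
    ext w
    simp
  have hUo : IsOpen {w : A → ℝ | ∀ a, 0 < w a} := by
    rw [hU]
    exact isOpen_set_pi Set.finite_univ fun _ _ => isOpen_Ioi
  have hUc : Convex ℝ {w : A → ℝ | ∀ a, 0 < w a} := by
    rw [hU]
    exact convex_pi fun _ _ => convex_Ioi 0
  refine contDiff_of_stationary_of_fderiv_pos (codagDirections tail head o d) hUo hUc
    (codagGradient π tail d s β)
    (fun p w hw => contDiffAt_codagGradient π tail d hs_contDiff β p hw) ?_ wbar h_pos hsub ?_
  · intro p w hw v hv
    have h1 : ContDiffAt ℝ 1 (fun y => codagGradient π tail d s β p y) w :=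
      (contDiffAt_codagGradient π tail d hs_contDiff β p hw).comp w
        (contDiffAt_const.prodMk contDiffAt_id)
    have h2 := (h1.differentiableAt one_ne_zero).hasFDerivAt.clm_apply (hasFDerivAt_const v w)
    have h3 : (fun w' => fderiv ℝ (fun w'' => F w'' p) w' v) =ᶠ[𝓝 w]
        fun w' => codagGradient π tail d s β p w' v := by
      filter_upwards [hUo.mem_nhds hw] with w' hw'
      rw [(hgrad p w' hw').fderiv]
    have h4 := h_hess p w hw v hv
    rw [h3.fderiv_eq, h2.fderiv] at h4
    simpa using h4
  · intro p v hv
    have h1 : HasDerivAt (fun t : ℝ => wbar p + t • v) v 0 := by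
      simpa using ((hasDerivAt_id (0 : ℝ)).smul_const v).const_add (wbar p)
    have h2 : HasFDerivAt (fun w => F w p) (codagGradient π tail d s β p (wbar p))
        (wbar p + (0 : ℝ) • v) := by
      simpa using hgrad p _ (h_pos p)
    refine IsLocalMin.hasDerivAt_eq_zero ?_ (h2.comp_hasDerivAt (0 : ℝ) h1)
    have hev : ∀ᶠ t : ℝ in 𝓝 0, wbar p + t • v ∈ {w : A → ℝ | ∀ a, 0 < w a} := by
      apply h1.continuousAt.eventually_mem
      simpa using hUo.mem_nhds (h_pos p)
    filter_upwards [hev] with t ht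
    have hmem : wbar p + t • v ∈ W := by
      have hp := h_mem p
      have htv := (codagDirections tail head o d).smul_mem t hv
      rw [hW] at hp ⊢
      refine ⟨fun a => (ht a).le, fun i ho hd => ?_, ?_⟩
      · have := htv.1 i ho hd
        simp only [Pi.add_apply, sum_add_distrib, hp.2.1 i ho hd, this]
      · have := htv.2
        simp only [Pi.add_apply, sum_add_distrib, hp.2.2, this, add_zero]
    simpa using h_min p _ hmem
end

section
/- Let n ≥ 1 and 0 ≤ d ≤ n. Let H be an n×n real symmetric positive definite matrix, let M be an n×d real matrix with orthonormal columns (MᵀM = I_d), and let B be an n×(n−d) real matrix with orthonormal columns that are orthogonal to the columns of M (BᵀB = I_{n−d} and MᵀB = 0). Then the n×n matrix obtained by stacking Mᵀ (as the first d rows) on top of BᵀH (as the last n−d rows) is invertible. -/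
open Matrix

/-- Compressing a positive definite quadratic form along an injective matrix keeps it
nonsingular. -/
theorem isUnit_transpose_mul_mul_of_pos {m k : Type*} [Fintype m] [Fintype k]
    [DecidableEq k] {H : Matrix m m ℝ} (hH : ∀ v : m → ℝ, v ≠ 0 → 0 < v ⬝ᵥ (H *ᵥ v))
    {B : Matrix m k ℝ} (hB : Bᵀ * B = 1) : IsUnit (Bᵀ * H * B) := by
  rw [← Matrix.mulVec_injective_iff_isUnit, ← Matrix.coe_mulVecLin, injective_iff_map_eq_zero]
  intro w hw
  rw [Matrix.mulVecLin_apply] at hw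
  have hBw : B *ᵥ w = 0 := by
    by_contra h
    have hquad : (B *ᵥ w) ⬝ᵥ (H *ᵥ (B *ᵥ w)) = w ⬝ᵥ ((Bᵀ * H * B) *ᵥ w) := by
      rw [← Matrix.mulVec_mulVec, ← Matrix.mulVec_mulVec, Matrix.dotProduct_mulVec w,
        Matrix.vecMul_transpose]
    exact (hH _ h).ne' (by rw [hquad, hw, dotProduct_zero])
  simpa [hB] using congrArg (Bᵀ *ᵥ ·) hBw

/-- Nonsingularity of the stacked matrix `[Mᵀ; BᵀH]` where `H` is symmetric positive
definite, `M` has orthonormal columns, and `B` has orthonormal columns orthogonal to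
the columns of `M`. -/
theorem stacked_matrix_invertible (n d : ℕ) (hn : 1 ≤ n) (hd : d ≤ n)
    (H : Matrix (Fin n) (Fin n) ℝ)
    (hHsymm : H.IsSymm)
    (hHpd : ∀ v : Fin n → ℝ, v ≠ 0 → 0 < v ⬝ᵥ (H *ᵥ v))
    (M : Matrix (Fin n) (Fin d) ℝ) (hM : Mᵀ * M = 1)
    (B : Matrix (Fin n) (Fin (n - d)) ℝ) (hB : Bᵀ * B = 1)
    (hMB : Mᵀ * B = 0) :
    ∃ K : Matrix (Fin n) (Fin d ⊕ Fin (n - d)) ℝ,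
      K * Matrix.fromRows Mᵀ (Bᵀ * H) = 1 ∧
      Matrix.fromRows Mᵀ (Bᵀ * H) * K = 1 := by
  have hprod : Matrix.fromRows Mᵀ (Bᵀ * H) * Matrix.fromCols M B =
      Matrix.fromBlocks 1 0 (Bᵀ * H * M) (Bᵀ * H * B) := by
    rw [Matrix.fromRows_mul_fromCols, hM, hMB]
  have hdet : IsUnit (Matrix.fromRows Mᵀ (Bᵀ * H) * Matrix.fromCols M B).det := by
    rw [hprod, Matrix.det_fromBlocks_zero₁₂, Matrix.det_one, one_mul,
      ← Matrix.isUnit_iff_isUnit_det]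
    exact isUnit_transpose_mul_mul_of_pos hHpd hB
  have hright := Matrix.mul_nonsing_inv _ hdet
  rw [Matrix.mul_assoc] at hright
  have e : Fin d ⊕ Fin (n - d) ≃ Fin n :=
    finSumFinEquiv.trans (finCongr (Nat.add_sub_cancel' hd))
  exact ⟨_, (Matrix.mul_eq_one_comm_of_equiv e).mp hright, hright⟩
end

section
/- (Existence of a marginal-cost toll fixed point.) There exists p̄ ∈ K such that p̄_b = w̄_b(p̄) · s_b'(w̄_b(p̄)) for every b ∈ A_O, where K := { y ∈ ℝ^{A_O} : y_b ≥ 0 for all b, and ∑_{b ∈ A_O} y_b ≤ |A_O| · g_o · max_{b ∈ A_O} s_b'(g_o) }. -/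
open Finset

/-- A set `B` is dominating for a family of rankings `r` if every point is ranked weakly below
all of `B` by at least one ranking. -/
def IsDominating {V I α : Type*} [LinearOrder α] (r : I → V → α) (B : Finset V) : Prop :=
  ∀ y, ∃ i, ∀ x ∈ B, r i y ≤ r i x

theorem IsDominating.mono {V I α : Type*} [LinearOrder α] {r : I → V → α} {B D : Finset V}
    (hB : IsDominating r B) (h : D ⊆ B) : IsDominating r D := fun y =>
  (hB y).imp fun _ hi x hx => hi x (h hx)

/-- A cell that misses some colour has an even number of facets carrying all colours but `i₀`. -/
theorem even_card_facets_of_image_ne_univ {V I : Type*} [Fintype V] [DecidableEq V] [Fintype I]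
    [DecidableEq I] (γ : V → I) (i₀ : I) (B : Finset V) (hB : #B = Fintype.card I)
    (hcol : B.image γ ≠ univ) :
    Even #{D : Finset V | (#D + 1 = Fintype.card I ∧ D.image γ = univ.erase i₀) ∧ D ⊆ B} := by
  set S : Finset (Finset V) :=
    {D : Finset V | (#D + 1 = Fintype.card I ∧ D.image γ = univ.erase i₀) ∧ D ⊆ B} with hS
  rcases S.eq_empty_or_nonempty with h | ⟨D, hD⟩
  · simp [h]
  have hmem : ∀ E, E ∈ S ↔ (#E + 1 = Fintype.card I ∧ E.image γ = univ.erase i₀) ∧ E ⊆ B := by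
    simp [hS]
  have herase : ∀ E ∈ S, ∃ z ∈ B, E = B.erase z := by
    intro E hE
    obtain ⟨⟨hc, -⟩, hsub⟩ := (hmem E).1 hE
    obtain ⟨z, hz, rfl⟩ := (covBy_iff_exists_insert.1
      (Finset.covBy_iff_card_sdiff_eq_one.2 ⟨hsub, by rw [card_sdiff_of_subset hsub]; omega⟩))
    exact ⟨z, mem_insert_self _ _, (erase_insert hz).symm⟩
  obtain ⟨x, hxB, rfl⟩ := herase D hD
  obtain ⟨⟨hc, him⟩, -⟩ := (hmem _).1 hD
  have hcard : #(univ.erase i₀ : Finset I) + 1 = Fintype.card I := by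
    rw [card_erase_add_one (mem_univ _), card_univ]
  have hne : ∀ z ∈ B, z ≠ x → γ z ≠ i₀ := by
    intro z hz hzx
    have : γ z ∈ (B.erase x).image γ := mem_image_of_mem _ (mem_erase.2 ⟨hzx, hz⟩)
    rw [him] at this
    exact (mem_erase.1 this).1
  have hhit : ∀ k, k ≠ i₀ → ∃ z ∈ B, z ≠ x ∧ γ z = k := by
    intro k hk
    have : k ∈ (B.erase x).image γ := by rw [him]; simp [hk]
    obtain ⟨z, hz, rfl⟩ := mem_image.1 this
    exact ⟨z, (mem_erase.1 hz).2, (mem_erase.1 hz).1, rfl⟩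
  have hx : γ x ≠ i₀ := by
    intro hx
    refine hcol (eq_univ_iff_forall.2 fun k => ?_)
    by_cases hk : k = i₀
    · exact mem_image.2 ⟨x, hxB, by rw [hx, hk]⟩
    · obtain ⟨z, hz, -, rfl⟩ := hhit k hk
      exact mem_image_of_mem _ hz
  obtain ⟨x', hx'B, hx'x, hγ⟩ := hhit _ hx
  have : S = {B.erase x, B.erase x'} := by
    ext E
    rw [mem_insert, mem_singleton]
    constructor
    · intro hE
      obtain ⟨z, hz, rfl⟩ := herase E hE
      obtain ⟨⟨hc', him'⟩, -⟩ := (hmem _).1 hE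
      by_contra! hcon
      have hinj : Set.InjOn γ (B.erase z : Finset V) :=
        injOn_of_card_image_eq (by rw [him']; omega)
      refine hx'x (hinj ?_ ?_ hγ)
      · exact mem_coe.2 (mem_erase.2 ⟨fun h => hcon.2 (by rw [h]), hx'B⟩)
      · exact mem_coe.2 (mem_erase.2 ⟨fun h => hcon.1 (by rw [h]), hxB⟩)
    · rintro (rfl | rfl)
      · exact hD
      refine (hmem _).2 ⟨⟨by rw [card_erase_add_one hx'B, hB], ?_⟩, erase_subset _ _⟩
      ext k
      simp only [mem_image, mem_erase, mem_univ, and_true]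
      constructor
      · rintro ⟨z, ⟨-, hz⟩, rfl⟩
        by_cases hzx : z = x
        · rwa [hzx]
        · exact hne z hz hzx
      · intro hk
        obtain ⟨z, hz, -, rfl⟩ := hhit k hk
        by_cases hzx : z = x'
        · exact ⟨x, ⟨hx'x.symm, hxB⟩, by rw [hzx, hγ]⟩
        · exact ⟨z, ⟨hzx, hz⟩, rfl⟩
  rw [this, card_pair]
  · exact even_two
  · intro h
    have : x' ∈ B.erase x := mem_erase.2 ⟨hx'x, hx'B⟩
    rw [h] at this
    exact (mem_erase.1 this).1 rfl

/-- Sperner's parity argument for an abstract family of cells. -/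
theorem exists_image_eq_univ_of_odd_card_cofacets {V I : Type*} [Fintype V] [DecidableEq V]
    [Fintype I] [DecidableEq I] (γ : V → I) (R : Finset (Finset V))
    (hR : ∀ B ∈ R, #B = Fintype.card I) (i₀ : I) (D₀ : Finset V)
    (hD₀ : #D₀ + 1 = Fintype.card I) (him : D₀.image γ = univ.erase i₀)
    (hodd : Odd #{B ∈ R | D₀ ⊆ B})
    (heven : ∀ D : Finset V, #D + 1 = Fintype.card I → D.image γ = univ.erase i₀ → D ≠ D₀ →
      Even #{B ∈ R | D ⊆ B}) :
    ∃ B ∈ R, B.image γ = univ := by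
  by_contra! hcon
  set S : Finset (Finset V) :=
    {D : Finset V | #D + 1 = Fintype.card I ∧ D.image γ = univ.erase i₀} with hS
  have hD₀S : D₀ ∈ S := by simp [hS, hD₀, him]
  have hdouble := sum_card_bipartiteAbove_eq_sum_card_bipartiteBelow (s := S) (t := R)
    (fun D B => D ⊆ B)
  have hright : Even (∑ B ∈ R, #(S.bipartiteBelow (fun D B => D ⊆ B) B)) := by
    refine even_sum _ fun B hB => ?_
    have := even_card_facets_of_image_ne_univ γ i₀ B (hR B hB) (hcon B hB)
    rwa [← filter_filter] at this
  have hleft : Odd (∑ D ∈ S, #(R.bipartiteAbove (fun D B => D ⊆ B) D)) := by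
    rw [← add_sum_erase _ _ hD₀S]
    refine Odd.add_even hodd (even_sum _ fun D hD => ?_)
    obtain ⟨hne, hD⟩ := mem_erase.1 hD
    obtain ⟨h₁, h₂⟩ := (mem_filter.1 hD).2
    exact heven D h₁ h₂ hne
  rw [hdouble] at hleft
  exact (Nat.not_even_iff_odd.2 hleft) hright

/-- Points above the minimum of `D` in every ranking except `k` (`m l` being the minimum for `l`). -/
def pivotRegion {V I α : Type*} [LinearOrder α] (r : I → V → α) (m : I → V) (k : I) : Set V :=
  {z | ∀ l, l ≠ k → r l (m l) < r l z}

/-- The points of `pivotRegion r m k` ranked highest by `k`. -/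
def IsPivot {V I α : Type*} [LinearOrder α] (r : I → V → α) (m : I → V) (k : I) (y : V) : Prop :=
  y ∈ pivotRegion r m k ∧ ∀ z ∈ pivotRegion r m k, r k z ≤ r k y

theorem exists_isPivot {V I α : Type*} [Finite V] [LinearOrder α] (r : I → V → α) (m : I → V)
    (k : I) (h : (pivotRegion r m k).Nonempty) : ∃ y, IsPivot r m k y :=
  Set.exists_max_image _ (r k) (Set.toFinite _) h

theorem IsPivot.eq {V I α : Type*} [LinearOrder α] {r : I → V → α}
    (hr : ∀ i, Function.Injective (r i)) {m : I → V} {k : I} {y z : V}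
    (hy : IsPivot r m k y) (hz : IsPivot r m k z) : y = z :=
  hr k (le_antisymm (hz.2 y hy.1) (hy.2 z hz.1))

/-- The dominating extensions of a dominating set of codimension one are its two pivots. -/
theorem IsDominating.exists_pivots {V I α : Type*} [DecidableEq V] [Fintype I]
    [DecidableEq I] [LinearOrder α] {r : I → V → α} (hr : ∀ i, Function.Injective (r i))
    {D : Finset V} (hD : IsDominating r D) (hne : D.Nonempty) (hcard : #D + 1 = Fintype.card I) :
    ∃ (m : I → V) (i j : I), (∀ k, m k ∈ D ∧ ∀ x ∈ D, r k (m k) ≤ r k x) ∧ i ≠ j ∧ m i = m j ∧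
      ∀ y, (y ∉ D ∧ IsDominating r (insert y D)) ↔ (IsPivot r m i y ∨ IsPivot r m j y) := by
  choose m hmD hm using fun k => exists_min_image D (r k) hne
  have heq : ∀ k, ∀ d ∈ D, r k d ≤ r k (m k) → m k = d := fun k d hd h =>
    hr k (le_antisymm (hm k d hd) h)
  have hsurj : ∀ d ∈ D, ∃ a, m a = d := fun d hd => by
    obtain ⟨a, ha⟩ := hD d
    exact ⟨a, heq a d hd (ha _ (hmD a))⟩
  obtain ⟨i, -, j, -, hij, hmij⟩ := exists_ne_map_eq_of_card_lt_of_maps_to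
    (s := (univ : Finset I)) (t := D) (f := m) (by rw [card_univ]; omega) (fun k _ => hmD k)
  have hpair : ∀ k l, k ≠ l → ∃ d ∈ D, ∀ a, m a = d → a = k ∨ a = l := by
    intro k l hkl
    by_contra! hcon
    have hsub : D ⊆ ((univ.erase k).erase l).image m := by
      intro d hd
      obtain ⟨a, ha, hak, hal⟩ := hcon d hd
      exact mem_image.2 ⟨a, by simp [hak, hal], ha⟩
    have h₁ := (card_le_card hsub).trans card_image_le
    have h₂ := card_erase_add_one (mem_univ k)
    have h₃ := card_erase_add_one (mem_erase.2 ⟨hkl.symm, mem_univ l⟩)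
    rw [card_univ] at h₂
    omega
  have hpivot : ∀ i j, i ≠ j → m i = m j → ∀ y, IsPivot r m i y →
      y ∉ D ∧ IsDominating r (insert y D) := by
    intro i j hij hmij y hy
    refine ⟨fun hyD => ?_, fun z => ?_⟩
    · obtain ⟨a, rfl⟩ := hsurj y hyD
      by_cases ha : a = i
      · subst ha
        have := hy.1 j hij.symm
        rw [hmij] at this
        exact this.false
      · exact (hy.1 a ha).false
    · by_cases hz : z ∈ pivotRegion r m i
      · refine ⟨i, forall_mem_insert _ _ _ |>.2 ⟨hy.2 z hz, ?_⟩⟩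
        obtain ⟨l, hl⟩ := hD z
        by_cases hli : l = i
        · exact hli ▸ hl
        · exact absurd (hz l hli) (not_lt.2 (hl _ (hmD l)))
      · simp only [pivotRegion, Set.mem_ofPred_eq, not_forall, not_lt] at hz
        obtain ⟨l, hli, hl⟩ := hz
        exact ⟨l, forall_mem_insert _ _ _ |>.2
          ⟨hl.trans (hy.1 l hli).le, fun x hx => hl.trans (hm l x hx)⟩⟩
  refine ⟨m, i, j, fun k => ⟨hmD k, hm k⟩, hij, hmij, fun y => ⟨?_, ?_⟩⟩
  · rintro ⟨hyD, hy⟩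
    have hlow : ∀ a, ∀ d ∈ D, (∀ x ∈ insert y D, r a d ≤ r a x) →
        m a = d ∧ r a (m a) < r a y := by
      intro a d hd ha
      have h := heq a d hd (ha _ (mem_insert_of_mem (hmD a)))
      refine ⟨h, lt_of_le_of_ne (h ▸ ha y (mem_insert_self _ _)) fun h' => hyD ?_⟩
      rw [← hr a h']
      exact hmD a
    obtain ⟨k, hk⟩ := hy y
    have hky : r k y ≤ r k (m k) := hk _ (mem_insert_of_mem (hmD k))
    have hkij : k = i ∨ k = j := by
      by_contra! hcon
      obtain ⟨d, hd, hdk⟩ := hpair k i hcon.1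
      obtain ⟨a, ha⟩ := hy d
      obtain ⟨had, hay⟩ := hlow a d hd ha
      rcases hdk a had with rfl | rfl
      · exact absurd hay (not_lt.2 hky)
      · rcases hdk j (hmij ▸ had) with h | h
        · exact hcon.2 h.symm
        · exact hij h.symm
    have hreg : y ∈ pivotRegion r m k := by
      intro l hl
      by_contra hcon
      obtain ⟨d, hd, hdk⟩ := hpair k l hl.symm
      obtain ⟨a, ha⟩ := hy d
      obtain ⟨had, hay⟩ := hlow a d hd ha
      rcases hdk a had with rfl | rfl
      · exact absurd hay (not_lt.2 hky)
      · exact hcon hay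
    have hpiv : IsPivot r m k y := by
      refine ⟨hreg, fun z hz => ?_⟩
      obtain ⟨a, ha⟩ := hy z
      by_cases hak : a = k
      · exact hak ▸ ha y (mem_insert_self _ _)
      · exact absurd (hz a hak) (not_lt.2 (ha _ (mem_insert_of_mem (hmD a))))
    rcases hkij with rfl | rfl
    · exact Or.inl hpiv
    · exact Or.inr hpiv
  · rintro (h | h)
    · exact hpivot i j hij hmij y h
    · exact hpivot j i hij.symm hmij.symm y h

theorem card_filter_cofacets {V : Type*} [Fintype V] [DecidableEq V] (P : Finset V → Prop)
    [DecidablePred P] (D : Finset V) (n : ℕ) (hn : #D + 1 = n) :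
    #{B ∈ ({B : Finset V | #B = n ∧ P B} : Finset (Finset V)) | D ⊆ B} =
      #{y | y ∉ D ∧ P (insert y D)} := by
  symm
  refine card_bij (fun y _ => insert y D) ?_ ?_ ?_
  · intro y hy
    simp only [mem_filter, mem_univ, true_and] at hy ⊢
    exact ⟨⟨by rw [card_insert_of_notMem hy.1, hn], hy.2⟩, subset_insert _ _⟩
  · intro y hy z hz h
    simp only [mem_filter, mem_univ, true_and] at hy hz
    exact (mem_insert.1 (h ▸ mem_insert_self y D)).resolve_right hy.1
  · intro B hB
    simp only [mem_filter, mem_univ, true_and] at hB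
    obtain ⟨⟨hc, hP⟩, hsub⟩ := hB
    obtain ⟨z, hz, rfl⟩ := (covBy_iff_exists_insert.1
      (Finset.covBy_iff_card_sdiff_eq_one.2 ⟨hsub, by rw [card_sdiff_of_subset hsub]; omega⟩))
    exact ⟨z, by simp [hz, hP], rfl⟩

/-- **Scarf's lemma**: given rankings with slack points `s i`, each lowest for `i` and above all
non-slack points for the other rankings, some dominating set carries all colours. -/
theorem exists_isDominating_image_eq_univ {V I α : Type*} [Fintype V] [DecidableEq V] [Fintype I]
    [DecidableEq I] [Nontrivial I] [LinearOrder α] (r : I → V → α)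
    (hr : ∀ i, Function.Injective (r i)) (s : I → V) (hmin : ∀ i v, r i (s i) ≤ r i v)
    (htop : ∀ i j v, j ≠ i → v ∉ Set.range s → r i v < r i (s j))
    (γ : V → I) (hγ : ∀ i, γ (s i) = i) :
    ∃ B : Finset V, IsDominating r B ∧ B.image γ = univ := by
  classical
  obtain ⟨i₀⟩ : Nonempty I := inferInstance
  have hs : Function.Injective s := Function.LeftInverse.injective hγ
  have hslt : ∀ i v, v ≠ s i → r i (s i) < r i v := fun i v hv =>
    lt_of_le_of_ne (hmin i v) fun h => hv (hr i h).symm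
  have hn : 1 < Fintype.card I := Fintype.one_lt_card
  have hcardD₀ : #((univ.erase i₀).image s) + 1 = Fintype.card I := by
    rw [card_image_of_injective _ hs, card_erase_add_one (mem_univ _), card_univ]
  have hnonempty : ∀ D : Finset V, #D + 1 = Fintype.card I → D.Nonempty := fun D hD =>
    card_pos.1 (by omega)
  suffices hex : ∃ B ∈ ({B : Finset V | #B = Fintype.card I ∧ IsDominating r B} :
      Finset (Finset V)), B.image γ = univ by
    obtain ⟨B, hB, hcol⟩ := hex
    exact ⟨B, (mem_filter.1 hB).2.2, hcol⟩
  refine exists_image_eq_univ_of_odd_card_cofacets γ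
    {B : Finset V | #B = Fintype.card I ∧ IsDominating r B} (by simp +contextual) i₀
    ((univ.erase i₀).image s) hcardD₀
    (by rw [image_image, show γ ∘ s = id from funext hγ, image_id]) ?_ ?_
  · rw [card_filter_cofacets _ _ _ hcardD₀]
    have hdom : IsDominating r ((univ.erase i₀).image s) := by
      intro y
      by_cases hy : ∃ l, l ≠ i₀ ∧ s l = y
      · obtain ⟨l, -, rfl⟩ := hy
        exact ⟨l, fun x _ => hmin l x⟩
      · refine ⟨i₀, fun x hx => ?_⟩
        obtain ⟨l, hl, rfl⟩ := mem_image.1 hx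
        by_cases hy' : y ∈ Set.range s
        · obtain ⟨k, rfl⟩ := hy'
          obtain rfl : k = i₀ := by
            by_contra hk
            exact hy ⟨k, hk, rfl⟩
          exact hmin _ _
        · exact (htop i₀ l y (mem_erase.1 hl).1 hy').le
    obtain ⟨m, i, j, hm, hij, hmij, hpiv⟩ := hdom.exists_pivots hr (hnonempty _ hcardD₀) hcardD₀
    simp only [hpiv]
    have hms : ∀ l, l ≠ i₀ → m l = s l := fun l hl =>
      hr l (le_antisymm ((hm l).2 _ (mem_image_of_mem _ (by simp [hl]))) (hmin l _))
    have key : ∀ j, j ≠ i₀ → m i₀ = m j →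
        #{y | IsPivot r m i₀ y ∨ IsPivot r m j y} = 1 := by
      intro j hj hmj
      obtain ⟨y, hy⟩ := exists_isPivot r m i₀ ⟨s i₀, fun l hl => by
        rw [hms l hl]
        exact hslt l _ fun h => hl (hs h).symm⟩
      refine card_eq_one.2 ⟨y, ?_⟩
      ext z
      simp only [mem_filter, mem_univ, true_and, mem_singleton]
      refine ⟨?_, fun h => Or.inl (h ▸ hy)⟩
      rintro (hz | hz)
      · exact hz.eq hr hy
      · exfalso
        have hz₀ := hz.1 i₀ hj.symm
        rw [hmj, hms j hj] at hz₀
        by_cases hzs : z ∈ Set.range s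
        · obtain ⟨k, rfl⟩ := hzs
          by_cases hk : k = i₀
          · subst hk
            exact absurd hz₀ (not_lt.2 (hmin _ _))
          by_cases hkj : k = j
          · subst hkj
            exact hz₀.false
          have := hz.1 k hkj
          rw [hms k hk] at this
          exact this.false
        · exact hz₀.not_gt (htop i₀ j z hj hzs)
    by_cases hi : i = i₀
    · subst hi
      rw [key j hij.symm hmij]
      exact odd_one
    · by_cases hj : j = i₀
      · subst hj
        simp only [or_comm (a := IsPivot r m i _)]
        rw [key i hij hmij.symm]
        exact odd_one
      · rw [hms i hi, hms j hj] at hmij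
        exact absurd (hs hmij) hij
  · intro D hD him hne
    rw [card_filter_cofacets _ _ _ hD]
    by_cases hdom : IsDominating r D
    swap
    · rw [filter_false_of_mem fun y _ h => hdom (h.2.mono (subset_insert _ _))]
      simp
    obtain ⟨v, hv, hvs⟩ : ∃ v ∈ D, v ∉ Set.range s := by
      by_contra! hcon
      refine hne (eq_of_subset_of_card_le (fun v hv => ?_) (by omega))
      obtain ⟨k, rfl⟩ := hcon v hv
      refine mem_image_of_mem _ ?_
      rw [← him]
      exact mem_image.2 ⟨s k, hv, hγ k⟩
    obtain ⟨m, i, j, hm, hij, hmij, hpiv⟩ := hdom.exists_pivots hr (hnonempty _ hD) hD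
    simp only [hpiv]
    have hex : ∀ k, ∃ y, IsPivot r m k y := fun k => exists_isPivot r m k
      ⟨s k, fun l hl => ((hm l).2 v hv).trans_lt (htop l k v hl.symm hvs)⟩
    obtain ⟨y, hy⟩ := hex i
    obtain ⟨z, hz⟩ := hex j
    have hset : ({x | IsPivot r m i x ∨ IsPivot r m j x} : Finset V) = {y, z} := by
      ext x
      simp only [mem_filter, mem_univ, true_and, mem_insert, mem_singleton]
      constructor
      · rintro (h | h)
        · exact Or.inl (h.eq hr hy)
        · exact Or.inr (h.eq hr hz)
      · rintro (rfl | rfl)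
        · exact Or.inl hy
        · exact Or.inr hz
    rw [hset, card_pair]
    · exact even_two
    · rintro rfl
      obtain ⟨l, hl⟩ := hdom y
      have hnot := not_lt.2 (hl _ (hm l).1)
      by_cases hli : l = i
      · exact hnot (hz.1 l (hli ▸ hij))
      · exact hnot (hy.1 l hli)

/-- A colouring of the lattice points of the simplex of size `N` has an approximate
panchromatic point. -/
theorem exists_panchromatic_lattice_point {I : Type*} [Fintype I] [Nontrivial I] (N : ℕ)
    (c : (I → ℕ) → I) :
    ∃ m : I → ℕ, N < ∑ i, m i + Fintype.card I ∧ (∃ x : I → ℕ, ∑ i, x i = N ∧ m ≤ x) ∧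
      ∀ i, m i = 0 ∨ ∃ x : I → ℕ, ∑ i, x i = N ∧ m ≤ x ∧ c x = i := by
  classical
  let T := {x : I → ℕ // x ∈ piAntidiag univ N}
  let _ : Fintype T := FinsetCoe.fintype _
  have hT : ∀ x : T, ∑ i, x.1 i = N := fun x => (mem_piAntidiag.1 x.2).1
  let e : T ⊕ I ≃ Fin (Fintype.card (T ⊕ I)) := Fintype.equivFin _
  let h : I → T ⊕ I → ℤ := fun i => Sum.elim (fun x => (x.1 i : ℤ))
    (fun j => if j = i then -1 else N + 1)
  let r : I → T ⊕ I → ℤ ×ₗ Fin (Fintype.card (T ⊕ I)) := fun i v => toLex (h i v, e v)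
  have hlt : ∀ i v w, h i v < h i w → r i v < r i w := fun i v w hvw =>
    Prod.Lex.toLex_lt_toLex.2 (Or.inl hvw)
  have hle : ∀ i v w, r i v ≤ r i w → h i v ≤ h i w := fun i v w hvw =>
    not_lt.1 fun hwv => hvw.not_gt (hlt i w v hwv)
  have hxN : ∀ (x : T) i, x.1 i ≤ N := fun x i =>
    (single_le_sum (f := x.1) (fun _ _ => Nat.zero_le _) (mem_univ i)).trans_eq (hT x)
  obtain ⟨B, hB, hcol⟩ := exists_isDominating_image_eq_univ r
    (fun i v w hvw => e.injective (Prod.ext_iff.1 (toLex.injective hvw)).2)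
    Sum.inr
    (fun i v => by
      by_cases hv : v = Sum.inr i
      · rw [hv]
      refine (hlt i _ _ ?_).le
      rcases v with x | j
      · simp only [h, Sum.elim_inl, Sum.elim_inr, if_true]
        omega
      · have : j ≠ i := fun hj => hv (by rw [hj])
        simp only [h, Sum.elim_inr, if_true, this, if_false]
        omega)
    (fun i j v hj hv => by
      rcases v with x | k
      · refine hlt i _ _ ?_
        have := hxN x i
        simp only [h, Sum.elim_inl, Sum.elim_inr, hj, if_false]
        omega
      · exact absurd ⟨k, rfl⟩ hv)
    (Sum.elim (fun x => c x.1) id) (fun i => rfl)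
  have hdom : ∀ y : T, ∃ i, Sum.inr i ∉ B ∧ ∀ x : T, Sum.inl x ∈ B → y.1 i ≤ x.1 i := by
    intro y
    obtain ⟨i, hi⟩ := hB (Sum.inl y)
    refine ⟨i, fun hiB => ?_, fun x hx => ?_⟩
    · have := hle _ _ _ (hi _ hiB)
      simp only [h, Sum.elim_inl, Sum.elim_inr, if_true] at this
      omega
    · have := hle _ _ _ (hi _ hx)
      simp only [h, Sum.elim_inl] at this
      omega
  have hcolor : ∀ i, Sum.inr i ∉ B → ∃ x : T, Sum.inl x ∈ B ∧ c x.1 = i := by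
    intro i hi
    have : i ∈ B.image (Sum.elim (fun x : T => c x.1) id) := by rw [hcol]; exact mem_univ i
    obtain ⟨v, hv, rfl⟩ := mem_image.1 this
    rcases v with x | j
    · exact ⟨x, hv, rfl⟩
    · exact absurd hv hi
  obtain ⟨a⟩ : Nonempty I := inferInstance
  have hpi : ∀ y : I → ℕ, ∑ i, y i = N → y ∈ piAntidiag univ N := fun y hy =>
    mem_piAntidiag.2 ⟨hy, fun _ _ => mem_univ _⟩
  obtain ⟨b, hb, -⟩ := hdom ⟨Pi.single a N, hpi _ (by simp)⟩
  obtain ⟨x₀, hx₀, -⟩ := hcolor b hb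
  have hminex : ∀ i, ∃ x : T, Sum.inl x ∈ B ∧ ∀ x' : T, Sum.inl x' ∈ B → x.1 i ≤ x'.1 i := by
    intro i
    obtain ⟨x, hx, hx'⟩ := exists_min_image ({x : T | Sum.inl x ∈ B} : Finset T)
      (fun x => x.1 i) ⟨x₀, by simpa using hx₀⟩
    exact ⟨x, by simpa using hx, fun x' h' => hx' x' (by simpa using h')⟩
  choose μ hμB hμ using hminex
  let m : I → ℕ := fun i => if Sum.inr i ∈ B then 0 else (μ i).1 i
  have hmle : ∀ x : T, Sum.inl x ∈ B → m ≤ x.1 := by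
    intro x hx i
    by_cases hi : Sum.inr i ∈ B
    · simp [m, hi]
    · simpa [m, hi] using hμ i x hx
  refine ⟨m, ?_, ⟨x₀.1, hT x₀, hmle x₀ hx₀⟩, fun i => ?_⟩
  · by_contra! hcon
    let y : I → ℕ := fun i =>
      (m i + 1) + (Pi.single a (N - (∑ i, m i + Fintype.card I)) : I → ℕ) i
    have hy : ∑ i, y i = N := by
      simp only [y, sum_add_distrib, sum_pi_single', mem_univ, if_true, sum_const, card_univ,
        smul_eq_mul, mul_one]
      omega
    obtain ⟨i, hiB, hi⟩ := hdom ⟨y, hpi y hy⟩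
    have := hi _ (hμB i)
    simp only [y, m, hiB, if_false] at this
    omega
  · by_cases hi : Sum.inr i ∈ B
    · exact Or.inl (by simp [m, hi])
    · obtain ⟨x, hx, hc⟩ := hcolor i hi
      exact Or.inr ⟨x.1, hT x, hmle x hx, hc⟩

/-- **Brouwer's fixed point theorem** for the standard simplex. -/
theorem exists_fixedPoint_stdSimplex {I : Type*} [Fintype I] [Nontrivial I]
    (f : (I → ℝ) → I → ℝ) (hf : ContinuousOn f (stdSimplex ℝ I))
    (hmaps : Set.MapsTo f (stdSimplex ℝ I) (stdSimplex ℝ I)) :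
    ∃ x ∈ stdSimplex ℝ I, f x = x := by
  by_contra! hcon
  have hcompact : IsCompact (stdSimplex ℝ I) := isCompact_stdSimplex ℝ I
  have hne : (stdSimplex ℝ I).Nonempty := by
    classical
    obtain ⟨i⟩ : Nonempty I := inferInstance
    exact ⟨_, single_mem_stdSimplex ℝ i⟩
  have hex : ∀ x ∈ stdSimplex ℝ I, ∃ i, f x i < x i := by
    intro x hx
    by_contra! h
    have hsum : ∑ i, x i = ∑ i, f x i := by rw [hx.2, (hmaps hx).2]
    refine hcon x hx (funext fun i => ?_)
    exact (((sum_eq_sum_iff_of_le fun i _ => h i).1 hsum) i (mem_univ i)).symm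
  let g : (I → ℝ) → ℝ := fun x => univ.sup' univ_nonempty fun i => x i - f x i
  have hg : ContinuousOn g (stdSimplex ℝ I) :=
    ContinuousOn.finset_sup'_apply _ fun i _ =>
      (continuous_apply i).continuousOn.sub ((continuous_apply i).comp_continuousOn hf)
  obtain ⟨z, hz, hzmin⟩ := hcompact.exists_isMinOn hne hg
  have hδ : 0 < g z := by
    obtain ⟨i, hi⟩ := hex z hz
    exact (sub_pos.2 hi).trans_le (le_sup' (fun i => z i - f z i) (mem_univ i))
  have hunif := Metric.uniformContinuousOn_iff.1
    (hcompact.uniformContinuousOn_of_continuous hf) (g z / 2) (half_pos hδ)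
  obtain ⟨η, hη, hfη⟩ := hunif
  set n := Fintype.card I
  obtain ⟨N, hN⟩ := exists_nat_gt ((n : ℝ) / min η (g z / 2))
  have hε : 0 < min η (g z / 2) := lt_min hη (half_pos hδ)
  have hN₀ : (0 : ℝ) < N := lt_of_le_of_lt (by positivity) hN
  have hnN : (n : ℝ) / N < min η (g z / 2) := by
    rw [div_lt_iff₀ hε] at hN
    rw [div_lt_iff₀ hN₀]
    linarith
  let q : (I → ℕ) → I → ℝ := fun x i => x i / N
  have hq : ∀ x : I → ℕ, ∑ i, x i = N → q x ∈ stdSimplex ℝ I := by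
    intro x hx
    refine ⟨fun i => by positivity, ?_⟩
    simp only [q, ← sum_div]
    rw [← Nat.cast_sum, hx, div_self hN₀.ne']
  have hcolex : ∀ x : I → ℕ, ∃ i, ∑ i, x i = N → q x i ≤ f (q x) i := by
    intro x
    by_cases hx : ∑ i, x i = N
    · have h := hq x hx
      obtain ⟨i, -, hi⟩ := exists_le_of_sum_le (s := univ) univ_nonempty
        (f := q x) (g := f (q x)) (by rw [h.2, (hmaps h).2])
      exact ⟨i, fun _ => hi⟩
    · obtain ⟨i⟩ : Nonempty I := inferInstance
      exact ⟨i, fun h => absurd h hx⟩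
  choose c hc using hcolex
  obtain ⟨m, hm, ⟨x, hx, hmx⟩, hpan⟩ := exists_panchromatic_lattice_point N c
  have hclose : ∀ y : I → ℕ, ∑ i, y i = N → m ≤ y → ∀ i, y i ≤ m i + n := by
    intro y hy hmy i
    have h₁ : ∑ i, (y i - m i) + ∑ i, m i = N := by
      rw [← sum_add_distrib, ← hy]
      exact sum_congr rfl fun i _ => Nat.sub_add_cancel (hmy i)
    have h₂ : y i - m i ≤ ∑ i, (y i - m i) :=
      single_le_sum (f := fun i => y i - m i) (fun _ _ => Nat.zero_le _) (mem_univ i)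
    omega
  have hcontra : g (q x) < g z := by
    refine (sup'_lt_iff _).2 fun i _ => ?_
    have hxi := hclose x hx hmx i
    have hmin₁ := min_le_left η (g z / 2)
    have hmin₂ := min_le_right η (g z / 2)
    rcases hpan i with h₀ | ⟨y, hy, hmy, hcy⟩
    · have h₁ : q x i ≤ n / N := by
        simp only [q]
        gcongr
        omega
      have h₂ := (hmaps (hq x hx)).1 i
      linarith
    · have hdist : ∀ k, |q x k - q y k| ≤ n / N := by
        intro k
        have hxk : (x k : ℝ) ≤ m k + n := mod_cast hclose x hx hmx k
        have hyk : (y k : ℝ) ≤ m k + n := mod_cast hclose y hy hmy k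
        have hxk' : (m k : ℝ) ≤ x k := mod_cast hmx k
        have hyk' : (m k : ℝ) ≤ y k := mod_cast hmy k
        simp only [q]
        rw [← sub_div, abs_div, abs_of_pos hN₀]
        gcongr
        rw [abs_le]
        constructor <;> linarith
      have hd : dist (q x) (q y) < η :=
        lt_of_le_of_lt ((dist_pi_le_iff (by positivity)).2 fun k => by
          rw [Real.dist_eq]; exact hdist k) (hnN.trans_le hmin₁)
      have hfd := (dist_le_pi_dist _ _ i).trans_lt (hfη _ (hq x hx) _ (hq y hy) hd)
      rw [Real.dist_eq] at hfd
      have h₁ := hc y hy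
      rw [hcy] at h₁
      have h₂ := abs_lt.1 hfd
      have h₃ := abs_le.1 (hdist i)
      linarith [h₂.1, h₃.2]
  exact hcontra.not_ge (hzmin (hq x hx))

/-- A continuous self-map of a corner simplex `{y ≥ 0, ∑ y ≤ R}` has a fixed point. -/
theorem exists_fixedPoint_cornerSimplex {A : Type*} [Fintype A] [Nonempty A] {R : ℝ} (hR : 0 < R)
    (F : (A → ℝ) → A → ℝ) (hF : Continuous F) (h₀ : ∀ p b, 0 ≤ F p b)
    (h₁ : ∀ p, ∑ b, F p b ≤ R) : ∃ p, F p = p := by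
  let u : (Option A → ℝ) → A → ℝ := fun x b => R * x (some b)
  let f : (Option A → ℝ) → Option A → ℝ := fun x o =>
    o.elim (1 - (∑ b, F (u x) b) / R) fun b => F (u x) b / R
  have hu : Continuous u := by fun_prop
  have hFu : ∀ b, Continuous fun x => F (u x) b := fun b =>
    (continuous_apply b).comp (hF.comp hu)
  have hf : Continuous f := by
    refine continuous_pi fun o => ?_
    rcases o with _ | b
    · exact continuous_const.sub ((continuous_finsetSum _ fun b _ => hFu b).div_const R)
    · exact (hFu b).div_const R
  obtain ⟨x, -, hx⟩ := exists_fixedPoint_stdSimplex f hf.continuousOn (by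
    intro x _
    refine ⟨fun o => ?_, ?_⟩
    · rcases o with _ | b
      · exact sub_nonneg.2 ((div_le_one hR).2 (h₁ _))
      · exact div_nonneg (h₀ _ b) hR.le
    · rw [Fintype.sum_option]
      simp [f, ← sum_div])
  refine ⟨u x, funext fun b => ?_⟩
  have hb : F (u x) b / R = x (some b) := congrFun hx (some b)
  change F (u x) b = R * x (some b)
  rw [← hb]
  field_simp

/-- Existence of a marginal-cost toll fixed point (via Brouwer's fixed point theorem). -/
theorem marginal_cost_toll_fixed_point_exists
    {A_O : Type*} [Fintype A_O] [Nonempty A_O]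
    (g_o : ℝ) (hg : 0 < g_o)
    (s s' : A_O → ℝ → ℝ)
    (hs_deriv : ∀ b, ∀ x ∈ Set.Ici (0 : ℝ), HasDerivWithinAt (s b) (s' b x) (Set.Ici 0) x)
    (hs'_cont : ∀ b, ContinuousOn (s' b) (Set.Ici 0))
    (hs'_nonneg : ∀ b, ∀ x ∈ Set.Icc (0 : ℝ) g_o, 0 ≤ s' b x)
    (hs'_mono : ∀ b, MonotoneOn (s' b) (Set.Icc 0 g_o))
    (wbar : A_O → (A_O → ℝ) → ℝ)
    (hwbar : ∀ b p, wbar b p ∈ Set.Icc 0 g_o)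
    (hwbar_cont : ∀ b, Continuous (wbar b))
    (K : Set (A_O → ℝ))
    (hK : K = {y : A_O → ℝ | (∀ b, 0 ≤ y b) ∧
      ∑ b : A_O, y b ≤
        (Fintype.card A_O : ℝ) * g_o * (univ.sup' univ_nonempty fun b => s' b g_o)}) :
    ∃ pbar ∈ K, ∀ b : A_O, pbar b = wbar b pbar * s' b (wbar b pbar) := by
  subst hK
  set M := univ.sup' univ_nonempty fun b => s' b g_o
  have hmem : g_o ∈ Set.Icc 0 g_o := ⟨hg.le, le_rfl⟩
  let F : (A_O → ℝ) → A_O → ℝ := fun p b => wbar b p * s' b (wbar b p)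
  have hF : Continuous F := continuous_pi fun b => (hwbar_cont b).mul
    ((hs'_cont b).comp_continuous (hwbar_cont b) fun p => (hwbar b p).1)
  have h₀ : ∀ p b, 0 ≤ F p b := fun p b =>
    mul_nonneg (hwbar b p).1 (hs'_nonneg b _ (hwbar b p))
  have hle : ∀ p, ∑ b, F p b ≤ Fintype.card A_O * g_o * M := by
    intro p
    have hb : ∀ b ∈ univ, F p b ≤ g_o * M := fun b hb =>
      mul_le_mul (hwbar b p).2
        ((hs'_mono b (hwbar b p) hmem (hwbar b p).2).trans (le_sup' (fun b => s' b g_o) hb))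
        (hs'_nonneg b _ (hwbar b p)) hg.le
    have := sum_le_card_nsmul univ (F p) _ hb
    rwa [card_univ, nsmul_eq_mul, ← mul_assoc] at this
  have hR : 0 < Fintype.card A_O * g_o * M + 1 :=
    add_pos_of_nonneg_of_pos ((sum_nonneg fun b _ => h₀ 0 b).trans (hle 0)) one_pos
  obtain ⟨p, hp⟩ := exists_fixedPoint_cornerSimplex hR F hF h₀ fun p =>
    (hle p).trans (le_add_of_nonneg_right zero_le_one)
  refine ⟨p, ⟨fun b => ?_, ?_⟩, fun b => (congrFun hp b).symm⟩
  · rw [← hp]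
    exact h₀ p b
  · have := hle p
    rwa [hp] at this
end

section
/- (Uniqueness and existence of the optimal toll.) There exists exactly one p̄ ∈ ℝ^{A_O} satisfying the fixed-point equation p̄_b = w̄(p̄)_b · s_b'(w̄(p̄)_b) for all b ∈ A_O, where w̄(p)_b := ∑_{a : π(a) = b} w̄(p)_a. -/
open Finset

/-- Gibbs' inequality for unnormalised nonnegative weights. -/
theorem sum_mul_log_sub_le {A : Type*} (t : Finset A) {w x : A → ℝ}
    (hw : ∀ a, 0 ≤ w a) (hx : ∀ a, 0 ≤ x a)
    (hwx : ∀ a, 0 < w a → 0 < x a) :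
    ∑ a ∈ t, w a * Real.log (x a) - (∑ a ∈ t, w a) * Real.log (∑ a ∈ t, x a) ≤
      ∑ a ∈ t, w a * Real.log (w a) - (∑ a ∈ t, w a) * Real.log (∑ a ∈ t, w a) := by
  set W := ∑ a ∈ t, w a with hWdef
  set X := ∑ a ∈ t, x a with hXdef
  have hW : 0 ≤ W := sum_nonneg fun a _ => hw a
  have hX : 0 ≤ X := sum_nonneg fun a _ => hx a
  have key : ∀ a ∈ t, w a * Real.log (x a) - w a * Real.log X ≤
      w a * Real.log (w a) - w a * Real.log W - w a + x a * (W / X) := by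
    intro a ha
    rcases (hw a).eq_or_lt with h | h
    · rw [← h]
      have := mul_nonneg (hx a) (div_nonneg hW hX)
      simpa using this
    · have hxa := hwx a h
      have hWp : 0 < W := h.trans_le (single_le_sum (fun a _ => hw a) ha)
      have hXp : 0 < X := hxa.trans_le (single_le_sum (fun a _ => hx a) ha)
      have hlog := Real.log_le_sub_one_of_pos
        (div_pos (mul_pos hxa hWp) (mul_pos h hXp))
      rw [Real.log_div (by positivity) (by positivity), Real.log_mul hxa.ne' hWp.ne',
        Real.log_mul h.ne' hXp.ne'] at hlog
      have h2 := mul_le_mul_of_nonneg_left hlog h.le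
      have h3 : w a * (x a * W / (w a * X) - 1) = x a * (W / X) - w a := by
        field_simp
      rw [h3] at h2
      linarith
  have hsum := sum_le_sum key
  simp only [sum_sub_distrib, sum_add_distrib, ← sum_mul, ← hWdef, ← hXdef] at hsum
  have hXW : X * (W / X) ≤ W := by
    rcases hX.eq_or_lt with h | h
    · rw [← h]; simpa using hW
    · rw [mul_div_cancel₀ _ h.ne']
  linarith

/-- The unnormalised negative entropy is convex on the nonnegative orthant. -/
theorem convexOn_sum_mul_log_sub {A : Type*} (t : Finset A) :
    ConvexOn ℝ {w : A → ℝ | ∀ a, 0 ≤ w a} (fun w : A → ℝ =>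
      ∑ a ∈ t, w a * Real.log (w a) - (∑ a ∈ t, w a) * Real.log (∑ a ∈ t, w a)) := by
  refine ⟨convex_Ici (0 : A → ℝ), ?_⟩
  intro w hw v hv c e hc he hce
  simp only [smul_eq_mul]
  rcases hc.eq_or_lt with rfl | hc
  · obtain rfl : e = 1 := by linarith
    simp
  rcases he.eq_or_lt with rfl | he
  · obtain rfl : c = 1 := by linarith
    simp
  have hx : ∀ a, (c • w + e • v) a = c * w a + e * v a := fun a => rfl
  have hx0 : ∀ a, 0 ≤ (c • w + e • v) a := fun a =>
    add_nonneg (mul_nonneg hc.le (hw a)) (mul_nonneg he.le (hv a))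
  have h1 := sum_mul_log_sub_le t hw hx0 fun a h =>
    add_pos_of_pos_of_nonneg (mul_pos hc h) (mul_nonneg he.le (hv a))
  have h2 := sum_mul_log_sub_le t hv hx0 fun a h =>
    add_pos_of_nonneg_of_pos (mul_nonneg hc.le (hw a)) (mul_pos he h)
  generalize hx' : c • w + e • v = x at *
  have e1 : ∑ a ∈ t, x a * Real.log (x a) =
      c * ∑ a ∈ t, w a * Real.log (x a) + e * ∑ a ∈ t, v a * Real.log (x a) := by
    rw [mul_sum, mul_sum, ← sum_add_distrib]
    refine sum_congr rfl fun a _ => ?_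
    rw [hx]; ring
  have e2 : (∑ a ∈ t, x a) * Real.log (∑ a ∈ t, x a) =
      c * ((∑ a ∈ t, w a) * Real.log (∑ a ∈ t, x a)) +
        e * ((∑ a ∈ t, v a) * Real.log (∑ a ∈ t, x a)) := by
    generalize Real.log (∑ a ∈ t, x a) = L
    rw [sum_congr rfl fun a _ => hx a, sum_add_distrib, ← mul_sum, ← mul_sum]
    ring
  rw [e1, e2]
  have := mul_le_mul_of_nonneg_left h1 hc.le
  have := mul_le_mul_of_nonneg_left h2 he.le
  linarith

theorem convexOn_finsetSum {ι E : Type*} [AddCommGroup E] [Module ℝ E] (t : Finset ι) {K : Set E}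
    (hK : Convex ℝ K) {f : ι → E → ℝ} (hf : ∀ i ∈ t, ConvexOn ℝ K (f i)) :
    ConvexOn ℝ K fun x => ∑ i ∈ t, f i x := by
  refine ⟨hK, fun x hx y hy c e hc he hce => ?_⟩
  simp only [smul_eq_mul, mul_sum, ← sum_add_distrib]
  exact sum_le_sum fun i hi => (hf i hi).2 hx hy hc he hce

/-- If a point minimizes `f + h` over a set on which `f` is convex, and `h` is stationary there
along every segment of the set, then the point minimizes `f`. -/
theorem ConvexOn.le_of_forall_add_le {E : Type*} [AddCommGroup E] [Module ℝ E] {K : Set E}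
    {f h : E → ℝ} (hf : ConvexOn ℝ K f) {x y : E} (hx : x ∈ K) (hy : y ∈ K)
    (hmin : ∀ z ∈ K, f x + h x ≤ f z + h z)
    (hh : HasDerivWithinAt (fun t : ℝ => h (x + t • (y - x))) 0 (Set.Icc 0 1) 0) :
    f x ≤ f y := by
  have hd : HasDerivWithinAt (fun t : ℝ => t * (f y - f x) + h (x + t • (y - x)))
      (1 * (f y - f x) + 0) (Set.Icc 0 1) 0 :=
    ((hasDerivWithinAt_id _ _).mul_const _).add hh
  have hIoc : HasDerivWithinAt (fun t : ℝ => t * (f y - f x) + h (x + t • (y - x)))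
      (1 * (f y - f x) + 0) (Set.Ioc 0 1) 0 := hd.mono Set.Ioc_subset_Icc_self
  rw [hasDerivWithinAt_iff_tendsto_slope' (by simp)] at hIoc
  have : (nhdsWithin (0 : ℝ) (Set.Ioc 0 1)).NeBot := by
    rw [nhdsWithin_Ioc_eq_nhdsGT one_pos]; infer_instance
  have hnn : 0 ≤ 1 * (f y - f x) + 0 := by
    refine ge_of_tendsto hIoc ?_
    filter_upwards [self_mem_nhdsWithin] with t ht
    have hz : x + t • (y - x) = (1 - t) • x + t • y := by module
    have hzK : x + t • (y - x) ∈ K := by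
      rw [hz]; exact hf.1 hx hy (by linarith [ht.2]) ht.1.le (by ring)
    have h1 := hmin _ hzK
    have h2 := hf.2 hx hy (sub_nonneg.2 ht.2) ht.1.le (by ring)
    rw [← hz] at h2
    simp only [smul_eq_mul] at h2
    rw [slope_def_field]
    refine div_nonneg ?_ (by linarith [ht.1])
    simp only [zero_smul, add_zero, zero_mul, zero_add]
    linarith
  linarith

theorem ContinuousOn.continuous_comp_max_zero {f : ℝ → ℝ} (hf : ContinuousOn f (Set.Ici 0)) :
    Continuous fun u => f (max u 0) :=
  hf.comp_continuous (by fun_prop) fun _ => Set.mem_Ici.2 (le_max_right _ _)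

/-- A primitive on the half-line of a function that is continuous there. -/
theorem hasDerivAt_integral_max {f : ℝ → ℝ} (hf : ContinuousOn f (Set.Ici 0)) (x : ℝ) :
    HasDerivAt (fun y => ∫ u in (0 : ℝ)..y, f (max u 0)) (f (max x 0)) x := by
  have hc := hf.continuous_comp_max_zero
  exact intervalIntegral.integral_hasDerivAt_right (hc.intervalIntegrable _ _)
    (hc.stronglyMeasurableAtFilter _ _) hc.continuousAt

theorem convexOn_integral_max {f : ℝ → ℝ} (hf : ContinuousOn f (Set.Ici 0))
    (hm : MonotoneOn f (Set.Ici 0)) :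
    ConvexOn ℝ Set.univ (fun y => ∫ u in (0 : ℝ)..y, f (max u 0)) := by
  refine Monotone.convexOn_univ_of_deriv
    (fun x => (hasDerivAt_integral_max hf x).differentiableAt) ?_
  rw [funext fun x => (hasDerivAt_integral_max hf x).deriv]
  exact fun x y hxy => hm (Set.mem_Ici.2 (le_max_right _ _)) (Set.mem_Ici.2 (le_max_right _ _))
    (max_le_max_right _ hxy)

theorem integral_add_const_eq_integral_max {f : ℝ → ℝ} (hf : ContinuousOn f (Set.Ici 0))
    (c : ℝ) {y : ℝ} (hy : 0 ≤ y) :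
    ∫ u in (0 : ℝ)..y, (f u + c) = (∫ u in (0 : ℝ)..y, f (max u 0)) + c * y := by
  have hc := hf.continuous_comp_max_zero
  have h : ∫ u in (0 : ℝ)..y, (f u + c) = ∫ u in (0 : ℝ)..y, (f (max u 0) + c) := by
    refine intervalIntegral.integral_congr fun u hu => ?_
    rw [Set.uIcc_of_le hy] at hu
    simp only [max_eq_left hu.1]
  rw [h, intervalIntegral.integral_add (hc.intervalIntegrable _ _)
    intervalIntegrable_const]
  simp [mul_comm]

theorem mul_self_strictMonoOn {f : ℝ → ℝ} (h0 : ∀ x ∈ Set.Ici (0 : ℝ), 0 ≤ f x)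
    (hf : StrictMonoOn f (Set.Ici 0)) : StrictMonoOn (fun x => x * f x) (Set.Ici 0) := by
  intro x hx y hy hxy
  have hx' : (0 : ℝ) ≤ x := hx
  exact mul_lt_mul'' hxy (hf hx hy hxy) hx' (h0 x hx)

/-- The marginal-cost defect `x ↦ x f(x) - ∫₀ˣ f - (x₀ f'(x₀)) x` is stationary at `x₀` along
segments of the half-line. -/
theorem hasDerivWithinAt_marginal_defect {f f' : ℝ → ℝ} (hf : ContinuousOn f (Set.Ici 0))
    (hd : ∀ x ∈ Set.Ici (0 : ℝ), HasDerivWithinAt f (f' x) (Set.Ici 0) x)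
    {x y : ℝ} (hx : 0 ≤ x) (hy : 0 ≤ y) :
    HasDerivWithinAt (fun t : ℝ => (fun z => z * f z - ((∫ u in (0 : ℝ)..z, f (max u 0)) +
      x * f' x * z)) (x + t * (y - x))) 0 (Set.Icc 0 1) 0 := by
  have h1 : HasDerivWithinAt (fun z => z * f z - ((∫ u in (0 : ℝ)..z, f (max u 0)) +
      x * f' x * z)) 0 (Set.Ici 0) x := by
    have := ((hasDerivWithinAt_id x (Set.Ici 0)).mul (hd x hx)).sub
      ((hasDerivAt_integral_max hf x).hasDerivWithinAt.add
        ((hasDerivWithinAt_id x (Set.Ici 0)).const_mul (x * f' x)))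
    refine this.congr_deriv ?_
    simp [max_eq_left hx]
  have h2 : HasDerivWithinAt (fun t : ℝ => x + t * (y - x)) (1 * (y - x)) (Set.Icc 0 1) 0 :=
    ((hasDerivWithinAt_id _ _).mul_const _).const_add _
  have h3 : Set.MapsTo (fun t : ℝ => x + t * (y - x)) (Set.Icc 0 1) (Set.Ici 0) := by
    intro t ht
    have : x + t * (y - x) = (1 - t) * x + t * y := by ring
    change 0 ≤ x + t * (y - x)
    rw [this]
    exact add_nonneg (mul_nonneg (sub_nonneg.2 ht.2) hx) (mul_nonneg ht.1 hy)
  have h4 := HasDerivWithinAt.comp (h := fun t : ℝ => x + t * (y - x)) (0 : ℝ)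
    (by simpa using h1) h2 h3
  simpa [Function.comp_def] using h4

/-- Existence and uniqueness of the optimal (marginal-cost) toll. -/
theorem optimal_toll_exists_unique
    {A_O A I : Type*} [Fintype A_O] [Fintype A] [Fintype I]
    [Nonempty A_O] [Nonempty A]
    [DecidableEq A_O] [DecidableEq A] [DecidableEq I]
    (π : A → A_O) (tail head : A → I) (o d : I) (hod : o ≠ d)
    (g_o : ℝ) (hg : 0 < g_o)
    (s s' : A_O → ℝ → ℝ)
    (hs_cont : ∀ b, ContinuousOn (s b) (Set.Ici 0))
    (hs_pos : ∀ b, ∀ x ∈ Set.Ici (0 : ℝ), 0 < s b x)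
    (hs_mono : ∀ b, StrictMonoOn (s b) (Set.Ici 0))
    (hs_deriv : ∀ b, ∀ x ∈ Set.Ici (0 : ℝ), HasDerivWithinAt (s b) (s' b x) (Set.Ici 0) x)
    (hs'_cont : ∀ b, ContinuousOn (s' b) (Set.Ici 0))
    (hs'_nonneg : ∀ b, ∀ x ∈ Set.Ici (0 : ℝ), 0 ≤ s' b x)
    (hs'_strictmono : ∀ b, StrictMonoOn (s' b) (Set.Ici 0))
    (β : ℝ) (hβ : 0 < β)
    (W : Set (A → ℝ))
    (hW : W = {w : A → ℝ | (∀ a, 0 ≤ w a) ∧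
      (∀ i, i ≠ o → i ≠ d →
        ∑ a ∈ univ.filter (fun a => tail a = i), w a =
        ∑ a ∈ univ.filter (fun a => head a = i), w a) ∧
      ∑ a ∈ univ.filter (fun a => tail a = o), w a = g_o})
    (F : (A → ℝ) → (A_O → ℝ) → ℝ)
    (hF : F = fun w p =>
      (∑ b : A_O,
        ∫ u in (0 : ℝ)..(∑ a ∈ univ.filter (fun a => π a = b), w a), (s b u + p b)) +
      (1 / β) * ∑ i ∈ univ.filter (fun i => i ≠ d),
        ((∑ a ∈ univ.filter (fun a => tail a = i), w a * Real.log (w a)) -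
         (∑ a ∈ univ.filter (fun a => tail a = i), w a) *
           Real.log (∑ a ∈ univ.filter (fun a => tail a = i), w a)))
    (wbar : (A_O → ℝ) → (A → ℝ))
    (h_mem : ∀ p, wbar p ∈ W)
    (h_min : ∀ p, ∀ w ∈ W, F (wbar p) p ≤ F w p)
    (h_unique : ∀ p, ∀ w ∈ W, (∀ w' ∈ W, F w p ≤ F w' p) → w = wbar p)
    (h_pos : ∀ p a, 0 < wbar p a)
    (h_cont : Continuous wbar)
    (h_agg_bdd : ∀ p b,
      0 < ∑ a ∈ univ.filter (fun a => π a = b), wbar p a ∧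
      ∑ a ∈ univ.filter (fun a => π a = b), wbar p a ≤ g_o) :
    ∃! pbar : A_O → ℝ, ∀ b : A_O,
      pbar b = (∑ a ∈ univ.filter (fun a => π a = b), wbar pbar a) *
        s' b (∑ a ∈ univ.filter (fun a => π a = b), wbar pbar a) := by
  have hg0 : ∀ w ∈ W, ∀ a, 0 ≤ w a := by
    intro w hw; rw [hW] at hw; exact hw.1
  have hagg0 : ∀ w ∈ W, ∀ b, 0 ≤ ∑ a ∈ univ.filter (fun a => π a = b), w a :=
    fun w hw b => sum_nonneg fun a _ => hg0 w hw a
  set agg : (A → ℝ) → A_O → ℝ := fun w b => ∑ a ∈ univ.filter (fun a => π a = b), w a with hagg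
  set S : A_O → ℝ → ℝ := fun b y => ∫ u in (0 : ℝ)..y, s b (max u 0) with hS
  set ent : (A → ℝ) → ℝ := fun w => (1 / β) * ∑ i ∈ univ.filter (fun i => i ≠ d),
        ((∑ a ∈ univ.filter (fun a => tail a = i), w a * Real.log (w a)) -
         (∑ a ∈ univ.filter (fun a => tail a = i), w a) *
           Real.log (∑ a ∈ univ.filter (fun a => tail a = i), w a)) with hent
  have hF' : ∀ w ∈ W, ∀ p, F w p = ∑ b, (S b (agg w b) + p b * agg w b) + ent w := by
    intro w hw p
    simp only [hF, hent]
    congr 1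
    exact sum_congr rfl fun b _ =>
      integral_add_const_eq_integral_max (hs_cont b) (p b) (hagg0 w hw b)
  change ∃! pbar : A_O → ℝ, ∀ b, pbar b = agg (wbar pbar) b * s' b (agg (wbar pbar) b)
  refine existsUnique_of_exists_of_unique ?_ ?_
  · set K : Set (A → ℝ) := W ∩ {w | ∀ b, agg w b ≤ g_o} with hK
    have hagg_cont : ∀ b, Continuous fun w => agg w b := fun b => by
      simp only [hagg]; fun_prop
    have hWconv : Convex ℝ W := by
      intro w hw v hv c e hc he hce
      rw [hW] at hw hv ⊢
      refine ⟨fun a => add_nonneg (mul_nonneg hc (hw.1 a)) (mul_nonneg he (hv.1 a)), ?_, ?_⟩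
      · intro i hio hid
        simp only [Pi.add_apply, Pi.smul_apply, smul_eq_mul, sum_add_distrib, ← mul_sum]
        rw [hw.2.1 i hio hid, hv.2.1 i hio hid]
      · simp only [Pi.add_apply, Pi.smul_apply, smul_eq_mul, sum_add_distrib, ← mul_sum]
        rw [hw.2.2, hv.2.2, ← add_mul, hce, one_mul]
    have hagg_lin : ∀ w v : A → ℝ, ∀ c e : ℝ, ∀ b,
        agg (c • w + e • v) b = c * agg w b + e * agg v b := by
      intro w v c e b
      simp only [hagg, Pi.add_apply, Pi.smul_apply, smul_eq_mul, sum_add_distrib, ← mul_sum]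
    have hKconv : Convex ℝ K := by
      refine hWconv.inter ?_
      intro w hw v hv c e hc he hce b
      rw [hagg_lin]
      have h1 := mul_le_mul_of_nonneg_left (hw b) hc
      have h2 := mul_le_mul_of_nonneg_left (hv b) he
      calc c * agg w b + e * agg v b ≤ c * g_o + e * g_o := add_le_add h1 h2
        _ = g_o := by rw [← add_mul, hce, one_mul]
    have hWclosed : IsClosed W := by
      rw [hW]
      simp only [Set.ofPred_and, Set.ofPred_forall]
      refine (isClosed_iInter fun a => isClosed_le (by fun_prop) (by fun_prop)).inter
        (IsClosed.inter ?_ (isClosed_eq (by fun_prop) (by fun_prop)))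
      exact isClosed_iInter fun i => isClosed_iInter fun _ => isClosed_iInter fun _ =>
        isClosed_eq (by fun_prop) (by fun_prop)
    have hKclosed : IsClosed K := by
      refine hWclosed.inter ?_
      simp only [Set.ofPred_forall]
      exact isClosed_iInter fun b => isClosed_le (hagg_cont b) continuous_const
    have hKcompact : IsCompact K := by
      refine (isCompact_Icc (a := (0 : A → ℝ)) (b := fun _ => g_o)).of_isClosed_subset hKclosed ?_
      intro w hw
      refine ⟨hg0 w hw.1, fun a => ?_⟩
      refine le_trans ?_ (hw.2 (π a))
      exact single_le_sum (f := w) (fun a _ => hg0 w hw.1 a) (by simp)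
    have hent_cont : Continuous ent := by
      refine continuous_const.mul (continuous_finsetSum _ fun i _ => ?_)
      refine (continuous_finsetSum _ fun a _ => ?_).sub ?_
      · exact Real.continuous_mul_log.comp (continuous_apply a)
      · exact Real.continuous_mul_log.comp
          (continuous_finsetSum _ fun a _ => continuous_apply a)
    have hG_cont : ContinuousOn (fun w => ∑ b, agg w b * s b (agg w b) + ent w) K := by
      refine ContinuousOn.add (continuousOn_finsetSum _ fun b _ => ?_) hent_cont.continuousOn
      exact (hagg_cont b).continuousOn.mul
        ((hs_cont b).comp (hagg_cont b).continuousOn fun w hw => hagg0 w hw.1 b)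
    have hbarK : ∀ p, wbar p ∈ K := fun p => ⟨h_mem p, fun b => (h_agg_bdd p b).2⟩
    obtain ⟨w, hwK, hwmin⟩ := hKcompact.exists_isMinOn ⟨_, hbarK 0⟩ hG_cont
    set p : A_O → ℝ := fun b => agg w b * s' b (agg w b) with hp
    have hent_conv : ConvexOn ℝ K ent := by
      have hconv := convexOn_finsetSum (univ.filter fun i => i ≠ d) hKconv fun i _ =>
        (convexOn_sum_mul_log_sub (univ.filter fun a => tail a = i)).subset
          (fun w hw => hg0 w hw.1) hKconv
      exact hconv.smul (c := 1 / β) (by positivity)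
    have hf_conv : ConvexOn ℝ K fun w => ∑ b, (S b (agg w b) + p b * agg w b) + ent w := by
      refine ConvexOn.add ⟨hKconv, ?_⟩ hent_conv
      intro w _ v _ c e hc he hce
      simp only [smul_eq_mul, mul_sum, ← sum_add_distrib]
      refine sum_le_sum fun b _ => ?_
      rw [hagg_lin]
      have := (convexOn_integral_max (hs_cont b) (hs_mono b).monotoneOn).2
        (Set.mem_univ (agg w b)) (Set.mem_univ (agg v b)) hc he hce
      simp only [smul_eq_mul] at this
      simp only [hS]
      linarith
    have hmin : F w p ≤ F (wbar p) p := by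
      rw [hF' _ hwK.1, hF' _ (h_mem p)]
      refine hf_conv.le_of_forall_add_le (h := fun w => ∑ b, (agg w b * s b (agg w b) -
        (S b (agg w b) + p b * agg w b))) hwK (hbarK p) ?_ ?_
      · intro z hz
        have h1 := hwmin hz
        simp only [Set.mem_ofPred_eq] at h1
        simp only [sum_sub_distrib]
        linarith
      · have h := HasDerivWithinAt.fun_sum (u := univ) fun b _ =>
          hasDerivWithinAt_marginal_defect (hs_cont b) (hs_deriv b)
            (hagg0 w hwK.1 b) (hagg0 _ (h_mem p) b)
        have hseg : ∀ t : ℝ, ∀ b, agg (w + t • (wbar p - w)) b =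
            agg w b + t * (agg (wbar p) b - agg w b) := by
          intro t b
          have : w + t • (wbar p - w) = (1 - t) • w + t • wbar p := by module
          rw [this, hagg_lin]; ring
        simp only [hseg]
        simpa using h
    have hw : w = wbar p :=
      h_unique p w hwK.1 fun w' hw' => hmin.trans (h_min p w' hw')
    exact ⟨p, fun b => by rw [← hw]⟩
  · intro p q hp hq
    have h1 := h_min p _ (h_mem q)
    have h2 := h_min q _ (h_mem p)
    rw [hF' _ (h_mem p), hF' _ (h_mem q)] at h1 h2
    simp only [sum_add_distrib] at h1 h2
    set w := agg (wbar p)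
    set v := agg (wbar q)
    have hsum : ∑ b, (p b - q b) * (w b - v b) ≤ 0 := by
      have : ∑ b, (p b - q b) * (w b - v b) =
          ∑ b, p b * w b - ∑ b, p b * v b - ∑ b, q b * w b + ∑ b, q b * v b := by
        simp only [← sum_sub_distrib, ← sum_add_distrib]
        exact sum_congr rfl fun b _ => by ring
      linarith
    have hmono : ∀ b, StrictMonoOn (fun x => x * s' b x) (Set.Ici 0) := fun b =>
      mul_self_strictMonoOn (hs'_nonneg b) (hs'_strictmono b)
    have hw0 : ∀ b, w b ∈ Set.Ici (0 : ℝ) := hagg0 _ (h_mem p)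
    have hv0 : ∀ b, v b ∈ Set.Ici (0 : ℝ) := hagg0 _ (h_mem q)
    have hpos : ∀ b, w b ≠ v b → 0 < (p b - q b) * (w b - v b) := by
      intro b hb
      rw [hp b, hq b]
      rcases lt_or_gt_of_ne hb with h | h
      · exact mul_pos_of_neg_of_neg (sub_neg.2 (hmono b (hw0 b) (hv0 b) h)) (sub_neg.2 h)
      · exact mul_pos (sub_pos.2 (hmono b (hv0 b) (hw0 b) h)) (sub_pos.2 h)
    have hnn : ∀ b ∈ univ, 0 ≤ (p b - q b) * (w b - v b) := by
      intro b _
      by_cases hb : w b = v b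
      · simp [hb]
      · exact (hpos b hb).le
    have hzero := (sum_eq_zero_iff_of_nonneg hnn).1 (le_antisymm hsum (sum_nonneg hnn))
    funext b
    have hb : w b = v b := by
      by_contra h
      exact (hpos b h).ne' (hzero b (mem_univ b))
    rw [hp b, hq b]
    change w b * s' b (w b) = v b * s' b (v b)
    rw [hb]
end

section
/- (Social optimality of the equilibrium under the optimal toll.) Let p̄ ∈ ℝ^{A_O} and let w̄ ∈ W have all coordinates strictly positive, and suppose that w̄ minimizes F(·, p̄) over W and that p̄_b = w̄_b · s_b'(w̄_b) for every b ∈ A_O. Then w̄ minimizes the social objective G over W, i.e., G(w̄) ≤ G(w) for all w ∈ W. -/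
open Finset

theorem sub_le_mul_log_sub_mul_log {x q : ℝ} (hx : 0 ≤ x) (hq : 0 < q) :
    x - q ≤ x * Real.log x - x * Real.log q := by
  rcases hx.eq_or_lt with rfl | hx
  · simpa using hq.le
  · have h := mul_le_mul_of_nonneg_left (Real.log_le_sub_one_of_pos (div_pos hq hx)) hx.le
    rw [Real.log_div hq.ne' hx.ne'] at h
    have h' : x * (q / x - 1) = q - x := by field_simp
    linarith

/-- Flow entropy at a node: `∑ wₐ log wₐ - (∑ wₐ) log (∑ wₐ)`. -/
noncomputable def flowEntropy {A : Type*} (S : Finset A) (w : A → ℝ) : ℝ :=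
  ∑ a ∈ S, w a * Real.log (w a) - (∑ a ∈ S, w a) * Real.log (∑ a ∈ S, w a)

theorem flowEntropy_eq_linear {A : Type*} (S : Finset A) (w : A → ℝ) :
    flowEntropy S w = ∑ a ∈ S, w a * (Real.log (w a) - Real.log (∑ a ∈ S, w a)) := by
  simp only [flowEntropy, mul_sub, sum_sub_distrib, sum_mul]

/-- Supporting hyperplane of the flow entropy at a positive flow `z`. -/
theorem linear_le_flowEntropy {A : Type*} (S : Finset A) {z x : A → ℝ}
    (hz : ∀ a, 0 < z a) (hx : ∀ a, 0 ≤ x a) :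
    ∑ a ∈ S, x a * (Real.log (z a) - Real.log (∑ a ∈ S, z a)) ≤ flowEntropy S x := by
  rw [flowEntropy_eq_linear]
  rcases (sum_nonneg fun a (_ : a ∈ S) => hx a).eq_or_lt with h0 | hX
  · have h := (sum_eq_zero_iff_of_nonneg fun a (_ : a ∈ S) => hx a).1 h0.symm
    exact (sum_congr rfl fun a ha => by simp [h a ha]).le
  have hS : S.Nonempty := by
    by_contra h
    simp [not_nonempty_iff_eq_empty.1 h] at hX
  have hZ : 0 < ∑ a ∈ S, z a := sum_pos (fun a _ => hz a) hS
  set X := ∑ a ∈ S, x a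
  set Z := ∑ a ∈ S, z a with hZdef
  have hsum : ∑ a ∈ S, (x a - X * z a / Z) = 0 := by
    rw [sum_sub_distrib, ← sum_div, ← mul_sum, ← hZdef, mul_div_cancel_right₀ _ hZ.ne']
    exact sub_self X
  rw [← sub_nonneg, ← sum_sub_distrib, ← hsum]
  refine sum_le_sum fun a _ => ?_
  have h := sub_le_mul_log_sub_mul_log (hx a) (div_pos (mul_pos hX (hz a)) hZ)
  rw [Real.log_div (mul_pos hX (hz a)).ne' hZ.ne', Real.log_mul hX.ne' (hz a).ne'] at h
  linarith

theorem flowEntropy_segment_le {A : Type*} (S : Finset A) {v w : A → ℝ}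
    (hv : ∀ a, 0 < v a) (hw : ∀ a, 0 ≤ w a) {t : ℝ} (ht₀ : 0 ≤ t) (ht₁ : t < 1) :
    flowEntropy S (fun a => (1 - t) * v a + t * w a) ≤
      (1 - t) * flowEntropy S v + t * flowEntropy S w := by
  have hz : ∀ a, 0 < (1 - t) * v a + t * w a := fun a =>
    add_pos_of_pos_of_nonneg (mul_pos (sub_pos.2 ht₁) (hv a)) (mul_nonneg ht₀ (hw a))
  have h₁ := mul_le_mul_of_nonneg_left (linear_le_flowEntropy S hz fun a => (hv a).le)
    (sub_pos.2 ht₁).le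
  have h₂ := mul_le_mul_of_nonneg_left (linear_le_flowEntropy S hz hw) ht₀
  refine le_of_eq_of_le ?_ (add_le_add h₁ h₂)
  rw [flowEntropy_eq_linear, mul_sum, mul_sum, ← sum_add_distrib]
  exact sum_congr rfl fun a _ => by ring

theorem convexOn_id_mul_of_monotoneOn {f : ℝ → ℝ} (hf : ConvexOn ℝ (Set.Ici 0) f)
    (hf₀ : ∀ x ∈ Set.Ici (0 : ℝ), 0 ≤ f x) (hmono : MonotoneOn f (Set.Ici 0)) :
    ConvexOn ℝ (Set.Ici 0) fun x => x * f x :=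
  (convexOn_id (convex_Ici 0)).mul hf (fun _ hx => hx) hf₀
    (monotoneOn_id.monovaryOn hmono)

theorem hasDerivWithinAt_integral_Ici {f : ℝ → ℝ} (hf : ContinuousOn f (Set.Ici 0)) {x : ℝ}
    (hx : 0 ≤ x) :
    HasDerivWithinAt (fun y => ∫ u in (0 : ℝ)..y, f u) (f x) (Set.Ici 0) x := by
  have hc : Continuous fun u => f (max u 0) :=
    hf.comp_continuous (continuous_id.max continuous_const) fun u => le_max_right u 0
  have h := (hc.integral_hasStrictDerivAt 0 x).hasDerivAt.hasDerivWithinAt (s := Set.Ici 0)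
  rw [max_eq_left hx] at h
  have heq : ∀ y ∈ Set.Ici (0 : ℝ),
      ∫ u in (0 : ℝ)..y, f u = ∫ u in (0 : ℝ)..y, f (max u 0) := fun y hy =>
    intervalIntegral.integral_congr fun u hu => by
      rw [Set.uIcc_of_le hy] at hu
      simp [max_eq_left hu.1]
  exact h.congr heq (heq x hx)

/-- Under the marginal-cost toll, the tolled Beckmann potential and the total latency have the same
derivative. -/
theorem hasDerivWithinAt_integral_toll_sub_mul {f : ℝ → ℝ} {f' x p : ℝ}
    (hf : ContinuousOn f (Set.Ici 0)) (hx : 0 ≤ x)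
    (hf' : HasDerivWithinAt f f' (Set.Ici 0) x) (hp : p = x * f') :
    HasDerivWithinAt (fun y => (∫ u in (0 : ℝ)..y, (f u + p)) - y * f y) 0 (Set.Ici 0) x := by
  have h := (hasDerivWithinAt_integral_Ici (f := fun u => f u + p)
    (hf.add continuousOn_const) hx).sub ((hasDerivWithinAt_id x (Set.Ici 0)).mul hf')
  refine h.congr_deriv ?_
  simp [hp]

/-- First-order optimality transfers between functions that agree to first order. -/
theorem le_of_convex_bound_of_hasDerivWithinAt_zero {φ γ : ℝ → ℝ} {c : ℝ}
    (hφ : ∀ t ∈ Set.Ioo (0 : ℝ) 1, φ 0 ≤ φ t)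
    (hγ : ∀ t ∈ Set.Ioo (0 : ℝ) 1, γ t ≤ (1 - t) * γ 0 + t * c)
    (hd : HasDerivWithinAt (fun t => φ t - γ t) 0 (Set.Ioo 0 1) 0) : γ 0 ≤ c := by
  rw [hasDerivWithinAt_iff_tendsto_slope' (by simp)] at hd
  have : (nhdsWithin (0 : ℝ) (Set.Ioo 0 1)).NeBot := by
    rw [nhdsWithin_Ioo_eq_nhdsGT one_pos]
    infer_instance
  refine sub_nonpos.1 (ge_of_tendsto hd ?_)
  filter_upwards [self_mem_nhdsWithin] with t ht
  rw [slope_def_field, sub_zero, le_div_iff₀ ht.1]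
  linarith [hφ t ht, hγ t ht]

/-- Social optimality of the CoDAG equilibrium under the marginal-cost (optimal) toll. -/
theorem equilibrium_under_optimal_toll_is_socially_optimal
    {A_O A I : Type*} [Fintype A_O] [Fintype A] [Fintype I]
    [Nonempty A_O] [Nonempty A]
    [DecidableEq A_O] [DecidableEq A] [DecidableEq I]
    (π : A → A_O) (tail head : A → I) (o d : I) (hod : o ≠ d)
    (g_o : ℝ) (hg : 0 < g_o)
    (s s' : A_O → ℝ → ℝ)
    (hs_cont : ∀ b, ContinuousOn (s b) (Set.Ici 0))
    (hs_pos : ∀ b, ∀ x ∈ Set.Ici (0 : ℝ), 0 < s b x)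
    (hs_mono : ∀ b, StrictMonoOn (s b) (Set.Ici 0))
    (hs_deriv : ∀ b, ∀ x ∈ Set.Ici (0 : ℝ), HasDerivWithinAt (s b) (s' b x) (Set.Ici 0) x)
    (hs'_cont : ∀ b, ContinuousOn (s' b) (Set.Ici 0))
    (hs_convex : ∀ b, ConvexOn ℝ (Set.Ici 0) (s b))
    (β : ℝ) (hβ : 0 < β)
    (W : Set (A → ℝ))
    (hW : W = {w : A → ℝ | (∀ a, 0 ≤ w a) ∧
      (∀ i, i ≠ o → i ≠ d →
        ∑ a ∈ univ.filter (fun a => tail a = i), w a =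
        ∑ a ∈ univ.filter (fun a => head a = i), w a) ∧
      ∑ a ∈ univ.filter (fun a => tail a = o), w a = g_o})
    (F : (A → ℝ) → (A_O → ℝ) → ℝ)
    (hF : F = fun w p =>
      (∑ b : A_O,
        ∫ u in (0 : ℝ)..(∑ a ∈ univ.filter (fun a => π a = b), w a), (s b u + p b)) +
      (1 / β) * ∑ i ∈ univ.filter (fun i => i ≠ d),
        ((∑ a ∈ univ.filter (fun a => tail a = i), w a * Real.log (w a)) -
         (∑ a ∈ univ.filter (fun a => tail a = i), w a) *
           Real.log (∑ a ∈ univ.filter (fun a => tail a = i), w a)))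
    (G : (A → ℝ) → ℝ)
    (hG : G = fun w =>
      (∑ b : A_O,
        (∑ a ∈ univ.filter (fun a => π a = b), w a) *
          s b (∑ a ∈ univ.filter (fun a => π a = b), w a)) +
      (1 / β) * ∑ i ∈ univ.filter (fun i => i ≠ d),
        ((∑ a ∈ univ.filter (fun a => tail a = i), w a * Real.log (w a)) -
         (∑ a ∈ univ.filter (fun a => tail a = i), w a) *
           Real.log (∑ a ∈ univ.filter (fun a => tail a = i), w a)))
    (pbar : A_O → ℝ) (wbar : A → ℝ)
    (h_mem : wbar ∈ W)
    (h_pos : ∀ a, 0 < wbar a)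
    (h_min : ∀ w ∈ W, F wbar pbar ≤ F w pbar)
    (h_fixed : ∀ b : A_O,
      pbar b = (∑ a ∈ univ.filter (fun a => π a = b), wbar a) *
        s' b (∑ a ∈ univ.filter (fun a => π a = b), wbar a)) :
    ∀ w ∈ W, G wbar ≤ G w := by
  subst hW hF hG
  intro w hw
  obtain ⟨hv₀, hv_cons, hv_o⟩ := h_mem
  obtain ⟨hw₀, hw_cons, hw_o⟩ := hw
  have hseg : ∀ (S : Finset A) (t : ℝ), ∑ a ∈ S, ((1 - t) * wbar a + t * w a) =
      (1 - t) * ∑ a ∈ S, wbar a + t * ∑ a ∈ S, w a := fun S t => by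
    rw [sum_add_distrib, mul_sum, mul_sum]
  have hnn : ∀ {v : A → ℝ}, (∀ a, 0 ≤ v a) → ∀ S : Finset A, 0 ≤ ∑ a ∈ S, v a :=
    fun h S => sum_nonneg fun a _ => h a
  let E : (A → ℝ) → ℝ := fun v => (1 / β) * ∑ i ∈ univ.filter (fun i => i ≠ d),
    flowEntropy (univ.filter fun a => tail a = i) v
  let seg : ℝ → A → ℝ := fun t a => (1 - t) * wbar a + t * w a
  let load : (A → ℝ) → A_O → ℝ := fun v b => ∑ a ∈ univ.filter (fun a => π a = b), v a
  let φ : ℝ → ℝ := fun t =>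
    (∑ b, ∫ u in (0 : ℝ)..load (seg t) b, (s b u + pbar b)) + E (seg t)
  let γ : ℝ → ℝ := fun t => (∑ b, load (seg t) b * s b (load (seg t) b)) + E (seg t)
  have hseg₀ : seg 0 = wbar := by simp [seg]
  have key : γ 0 ≤ (∑ b, load w b * s b (load w b)) + E w := by
    refine le_of_convex_bound_of_hasDerivWithinAt_zero (φ := φ) ?_ ?_ ?_
    · rintro t ⟨ht₀, ht₁⟩
      have := h_min (seg t) ⟨fun a => add_nonneg (mul_nonneg (sub_nonneg.2 ht₁.le) (hv₀ a))
        (mul_nonneg ht₀.le (hw₀ a)), fun i hio hid => ?_, ?_⟩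
      · simp only [φ, hseg₀]
        exact this
      · rw [hseg, hseg, hv_cons i hio hid, hw_cons i hio hid]
      · rw [hseg, hv_o, hw_o]
        ring
    · rintro t ⟨ht₀, ht₁⟩
      have hlat : ∑ b, load (seg t) b * s b (load (seg t) b) ≤
          (1 - t) * ∑ b, load wbar b * s b (load wbar b) +
            t * ∑ b, load w b * s b (load w b) := by
        rw [mul_sum, mul_sum, ← sum_add_distrib]
        refine sum_le_sum fun b _ => ?_
        have h := (convexOn_id_mul_of_monotoneOn (hs_convex b) (fun x hx => (hs_pos b x hx).le)
          (hs_mono b).monotoneOn).2 (hnn hv₀ (univ.filter fun a => π a = b))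
          (hnn hw₀ (univ.filter fun a => π a = b)) (sub_nonneg.2 ht₁.le) ht₀.le (by ring)
        simpa only [load, seg, hseg, smul_eq_mul] using h
      have hE : E (seg t) ≤ (1 - t) * E wbar + t * E w := by
        have h := mul_le_mul_of_nonneg_left (sum_le_sum fun i (_ : i ∈ univ.filter (· ≠ d)) =>
          flowEntropy_segment_le (univ.filter fun a => tail a = i) h_pos hw₀ ht₀.le ht₁)
          (one_div_pos.2 hβ).le
        refine h.trans_eq ?_
        rw [sum_add_distrib, ← mul_sum, ← mul_sum]
        simp only [E]
        ring
      simp only [γ, hseg₀]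
      linarith
    · have hsum : HasDerivWithinAt (fun t => ∑ b, ((∫ u in (0 : ℝ)..load (seg t) b,
          (s b u + pbar b)) - load (seg t) b * s b (load (seg t) b))) (∑ _b : A_O, (0 : ℝ))
          (Set.Ioo 0 1) 0 := by
        refine HasDerivWithinAt.fun_sum fun b _ => ?_
        have hx := hnn hv₀ (univ.filter fun a => π a = b)
        have hy := hnn hw₀ (univ.filter fun a => π a = b)
        have hout := hasDerivWithinAt_integral_toll_sub_mul (hs_cont b) hx (hs_deriv b _ hx)
          (h_fixed b)
        have hin : HasDerivWithinAt (fun t => load (seg t) b) (load w b - load wbar b)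
            (Set.Ioo 0 1) 0 := by
          have h := (((hasDerivAt_id (0 : ℝ)).const_sub 1).mul_const (load wbar b)).add
            ((hasDerivAt_id (0 : ℝ)).mul_const (load w b))
          refine (h.hasDerivWithinAt.congr_deriv (by ring)).congr (fun t _ => hseg _ t)
            (hseg _ 0)
        have hmaps : Set.MapsTo (fun t => load (seg t) b) (Set.Ioo 0 1) (Set.Ici 0) := by
          rintro t ⟨ht₀, ht₁⟩
          exact (add_nonneg (mul_nonneg (sub_nonneg.2 ht₁.le) hx)
            (mul_nonneg ht₀.le hy)).trans_eq (hseg _ t).symm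
        have h := HasDerivWithinAt.comp_of_eq (0 : ℝ) hout hin hmaps (by simp only [load, hseg₀])
        exact h.congr_deriv (zero_mul _)
      rw [sum_const_zero] at hsum
      have heq : (fun t => φ t - γ t) = fun t => ∑ b, ((∫ u in (0 : ℝ)..load (seg t) b,
          (s b u + pbar b)) - load (seg t) b * s b (load (seg t) b)) := by
        funext t
        simp only [φ, γ, sum_sub_distrib]
        ring
      rwa [heq]
  simp only [γ, hseg₀] at key
  exact key
end

section
/- (Main theorem: optimal toll exists, is unique, and induces the perturbed socially optimal flow.) There exists exactly one p̄ ∈ ℝ^{A_O} satisfying p̄_b = w̄(p̄)_b · s_b'(w̄(p̄)_b) for all b ∈ A_O (where w̄(p)_b := ∑_{a : π(a) = b} w̄(p)_a); moreover, for this p̄ the equilibrium flow w̄(p̄) minimizes the social objective G over W. -/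
open Finset

/-- The tangent line of a function with monotone derivative on `[0, ∞)` lies below its graph. -/
theorem tangent_le_of_monotoneOn_deriv {K k : ℝ → ℝ}
    (hK : ∀ x ∈ Set.Ici (0 : ℝ), HasDerivWithinAt K (k x) (Set.Ici 0) x)
    (hk : MonotoneOn k (Set.Ici 0)) {x y : ℝ} (hx : 0 ≤ x) (hy : 0 ≤ y) :
    K x + k x * (y - x) ≤ K y := by
  have slope : ∀ u v : ℝ, 0 ≤ u → u < v → ∃ c ∈ Set.Ioo u v, k c = (K v - K u) / (v - u) := by
    intro u v hu huv
    refine exists_hasDerivAt_eq_slope K k huv (fun z hz => ?_) (fun z hz => ?_)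
    · exact ((hK z (hu.trans hz.1)).continuousWithinAt).mono
        (fun r hr => hu.trans hr.1)
    · exact (hK z (hu.trans hz.1.le)).hasDerivAt (Ici_mem_nhds (hu.trans_lt hz.1))
  rcases lt_trichotomy x y with h | h | h
  · obtain ⟨c, hc, he⟩ := slope x y hx h
    have hkc : k x ≤ k c := hk hx (hx.trans hc.1.le) hc.1.le
    rw [he, le_div_iff₀ (sub_pos.2 h)] at hkc
    linarith
  · simp [h]
  · obtain ⟨c, hc, he⟩ := slope y x hy h
    have hkc : k c ≤ k x := hk (hy.trans hc.1.le) hx hc.2.le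
    rw [he, div_le_iff₀ (sub_pos.2 h)] at hkc
    linarith

theorem nonneg_of_hasDerivWithinAt_of_le {ψ : ℝ → ℝ} {D : ℝ}
    (hψ : HasDerivWithinAt ψ D (Set.Icc 0 1) 0) (hle : ∀ t ∈ Set.Icc (0 : ℝ) 1, ψ 0 ≤ ψ t) :
    0 ≤ D := by
  have hIoc : HasDerivWithinAt ψ D (Set.Ioc 0 1) 0 := hψ.mono Set.Ioc_subset_Icc_self
  rw [hasDerivWithinAt_iff_tendsto_slope' (by simp)] at hIoc
  have : (nhdsWithin (0 : ℝ) (Set.Ioc 0 1)).NeBot := by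
    rw [nhdsWithin_Ioc_eq_nhdsGT zero_lt_one]
    infer_instance
  refine ge_of_tendsto hIoc (eventually_nhdsWithin_of_forall fun t ht => ?_)
  rw [slope_def_field]
  exact div_nonneg (sub_nonneg.2 (hle t ⟨ht.1.le, ht.2⟩)) (by linarith [ht.1])

theorem StrictMonoOn.cross_sum_nonpos {k : ℝ → ℝ} {S : Set ℝ} (hk : StrictMonoOn k S) {x y : ℝ}
    (hx : x ∈ S) (hy : y ∈ S) :
    k x * (y - x) + k y * (x - y) ≤ 0 ∧ (k x * (y - x) + k y * (x - y) = 0 → y = x) := by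
  rcases lt_trichotomy y x with h | h | h
  · have := mul_pos (sub_pos.2 (hk hy hx h)) (sub_pos.2 h)
    exact ⟨by linarith, fun _ => by linarith⟩
  · simp [h]
  · have := mul_pos (sub_pos.2 (hk hx hy h)) (sub_pos.2 h)
    exact ⟨by linarith, fun _ => by linarith⟩

/-- Minimizers of a smooth separable function of finitely many linear forms plus a convex function
are characterized by a variational inequality that only differentiates the smooth part. -/
theorem isMinOn_iff_variational_inequality {ι E : Type*} [Fintype ι] [AddCommGroup E] [Module ℝ E]
    {W : Set E} {H : E → ℝ} (hH : ConvexOn ℝ W H) (L : ι → E →ₗ[ℝ] ℝ)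
    (hL : ∀ b, ∀ w ∈ W, 0 ≤ L b w) {K k : ι → ℝ → ℝ}
    (hK : ∀ b, ∀ x ∈ Set.Ici (0 : ℝ), HasDerivWithinAt (K b) (k b x) (Set.Ici 0) x)
    (hk : ∀ b, MonotoneOn (k b) (Set.Ici 0)) {w : E} (hw : w ∈ W) :
    (∀ v ∈ W, ∑ b, K b (L b w) + H w ≤ ∑ b, K b (L b v) + H v) ↔
      ∀ v ∈ W, 0 ≤ ∑ b, k b (L b w) * (L b v - L b w) + (H v - H w) := by
  constructor
  · intro hmin v hv
    have hmem : ∀ b, ∀ t ∈ Set.Icc (0 : ℝ) 1, 0 ≤ L b w + t * (L b v - L b w) := by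
      intro b t ht
      nlinarith [mul_nonneg ht.1 (hL b v hv), mul_nonneg (sub_nonneg.2 ht.2) (hL b w hw)]
    have hderiv : HasDerivWithinAt
        (fun t : ℝ => ∑ b, K b (L b w + t * (L b v - L b w)) + t * (H v - H w))
        (∑ b, k b (L b w) * (L b v - L b w) + (H v - H w)) (Set.Icc 0 1) 0 := by
      refine HasDerivWithinAt.add (HasDerivWithinAt.fun_sum fun b _ => ?_) ?_
      · have hinner : HasDerivWithinAt (fun t : ℝ => L b w + t * (L b v - L b w))
            (L b v - L b w) (Set.Icc 0 1) 0 := by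
          simpa using ((hasDerivWithinAt_id (0 : ℝ) (Set.Icc 0 1)).mul_const
            (L b v - L b w)).const_add (L b w)
        have houter := hK b (L b w) (hL b w hw)
        exact HasDerivWithinAt.comp_of_eq (h₂ := K b) (0 : ℝ) houter hinner (hmem b) (by simp)
      · simpa using (hasDerivWithinAt_id (0 : ℝ) (Set.Icc 0 1)).mul_const (H v - H w)
    refine nonneg_of_hasDerivWithinAt_of_le hderiv fun t ht => ?_
    have h1t : 0 ≤ 1 - t := sub_nonneg.2 ht.2
    have hbound := hmin _ (hH.1 hw hv h1t ht.1 (by ring))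
    have hconv := hH.2 hw hv h1t ht.1 (by ring)
    have harg : ∀ b, L b ((1 - t) • w + t • v) = L b w + t * (L b v - L b w) := by
      intro b
      simp only [map_add, map_smul, smul_eq_mul]
      ring
    simp only [harg, smul_eq_mul] at hbound hconv
    simp only [zero_mul, add_zero]
    linarith
  · intro hvi v hv
    have hsum : ∑ b, (K b (L b w) + k b (L b w) * (L b v - L b w)) ≤ ∑ b, K b (L b v) :=
      Finset.sum_le_sum fun b _ =>
        tangent_le_of_monotoneOn_deriv (hK b) (hk b) (hL b w hw) (hL b v hv)
    rw [Finset.sum_add_distrib] at hsum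
    linarith [hvi v hv]

/-- The supporting hyperplane of the perspective function `(y, T) ↦ y * log (y / T)`. -/
theorem perspective_log_ge {x S y T : ℝ} (hx : 0 < x) (hS : 0 < S) (hy : 0 ≤ y) (hyT : y ≤ T) :
    y * (Real.log x - Real.log S) + y - T * (x / S) ≤ y * Real.log y - y * Real.log T := by
  rcases hy.eq_or_lt with rfl | hy
  · have : 0 ≤ T * (x / S) := by positivity
    simpa using this
  · have hT : 0 < T := hy.trans_le hyT
    have hlog := Real.log_le_sub_one_of_pos (show 0 < (T * x) / (y * S) by positivity)
    rw [Real.log_div (by positivity) (by positivity), Real.log_mul hT.ne' hx.ne',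
      Real.log_mul hy.ne' hS.ne'] at hlog
    have hmul := mul_le_mul_of_nonneg_left hlog hy.le
    have hcancel : y * ((T * x) / (y * S) - 1) = T * (x / S) - y := by
      field_simp
    rw [hcancel] at hmul
    linarith

theorem perspective_log_convex {x₁ T₁ x₂ T₂ a b : ℝ} (hx₁ : 0 ≤ x₁) (hxT₁ : x₁ ≤ T₁)
    (hx₂ : 0 ≤ x₂) (hxT₂ : x₂ ≤ T₂) (ha : 0 ≤ a) (hb : 0 ≤ b) :
    (a * x₁ + b * x₂) * Real.log (a * x₁ + b * x₂) -
        (a * x₁ + b * x₂) * Real.log (a * T₁ + b * T₂) ≤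
      a * (x₁ * Real.log x₁ - x₁ * Real.log T₁) + b * (x₂ * Real.log x₂ - x₂ * Real.log T₂) := by
  have h₁ := mul_nonneg ha hx₁
  have h₂ := mul_nonneg hb hx₂
  rcases (add_nonneg h₁ h₂).eq_or_lt with h | h
  · have e₁ : a * x₁ = 0 := by linarith
    have e₂ : b * x₂ = 0 := by linarith
    simp only [mul_sub, ← mul_assoc, e₁, e₂]
    simp
  · have hS : 0 < a * T₁ + b * T₂ :=
      h.trans_le (add_le_add (mul_le_mul_of_nonneg_left hxT₁ ha)
        (mul_le_mul_of_nonneg_left hxT₂ hb))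
    have p₁ := mul_le_mul_of_nonneg_left (perspective_log_ge h hS hx₁ hxT₁) ha
    have p₂ := mul_le_mul_of_nonneg_left (perspective_log_ge h hS hx₂ hxT₂) hb
    have hcancel : a * (T₁ * ((a * x₁ + b * x₂) / (a * T₁ + b * T₂))) +
        b * (T₂ * ((a * x₁ + b * x₂) / (a * T₁ + b * T₂))) = a * x₁ + b * x₂ := by
      field_simp
    linarith

/-- The total of `w` over the fibre of `f` above `j`, as a linear form. -/
def fiberSum {A J : Type*} [Fintype A] [DecidableEq J] (f : A → J) (j : J) : (A → ℝ) →ₗ[ℝ] ℝ :=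
  ∑ a ∈ univ.filter (fun a => f a = j), LinearMap.proj a

section FiberSum

variable {A J : Type*} [Fintype A] [DecidableEq J] (f : A → J)

theorem fiberSum_apply (j : J) (w : A → ℝ) :
    fiberSum f j w = ∑ a ∈ univ.filter (fun a => f a = j), w a := by
  simp [fiberSum]

theorem continuous_fiberSum (j : J) : Continuous (fiberSum f j) := by
  simp only [funext (fiberSum_apply f j)]
  fun_prop

theorem fiberSum_nonneg {w : A → ℝ} (hw : ∀ a, 0 ≤ w a) (j : J) : 0 ≤ fiberSum f j w := by
  rw [fiberSum_apply]
  exact Finset.sum_nonneg fun a _ => hw a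

theorem le_fiberSum {w : A → ℝ} (hw : ∀ a, 0 ≤ w a) {j : J} {a : A} (ha : f a = j) :
    w a ≤ fiberSum f j w := by
  rw [fiberSum_apply]
  exact Finset.single_le_sum (fun a _ => hw a) (by simpa using ha)

theorem sum_fiberSum [Fintype J] (w : A → ℝ) : ∑ j, fiberSum f j w = ∑ a, w a := by
  simp only [fiberSum_apply]
  exact Finset.sum_fiberwise univ f w

/-- The negative entropy of the routing probabilities at the nodes other than `d`, weighted by the
node flows. -/
noncomputable def routingEntropy [Fintype J] (d : J) (w : A → ℝ) : ℝ :=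
  ∑ i ∈ univ.filter (fun i => i ≠ d),
    ((∑ a ∈ univ.filter (fun a => f a = i), w a * Real.log (w a)) -
      fiberSum f i w * Real.log (fiberSum f i w))

variable [Fintype J] (d : J)

theorem routingEntropy_eq (w : A → ℝ) :
    routingEntropy f d w = ∑ i ∈ univ.filter (fun i => i ≠ d),
      ∑ a ∈ univ.filter (fun a => f a = i),
        (w a * Real.log (w a) - w a * Real.log (fiberSum f i w)) := by
  refine Finset.sum_congr rfl fun i _ => ?_
  rw [Finset.sum_sub_distrib, ← Finset.sum_mul, ← fiberSum_apply f i w]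

theorem continuous_routingEntropy : Continuous (routingEntropy f d) := by
  refine continuous_finsetSum _ fun i _ => Continuous.sub ?_ ?_
  · exact continuous_finsetSum _ fun a _ => Real.continuous_mul_log.comp (continuous_apply a)
  · exact Real.continuous_mul_log.comp (continuous_fiberSum f i)

theorem convexOn_routingEntropy : ConvexOn ℝ {w : A → ℝ | ∀ a, 0 ≤ w a} (routingEntropy f d) := by
  refine ⟨fun w hw v hv x y hx hy _ a => ?_, fun w hw v hv x y hx hy _ => ?_⟩
  · exact add_nonneg (mul_nonneg hx (hw a)) (mul_nonneg hy (hv a))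
  · simp only [routingEntropy_eq, smul_eq_mul, Finset.mul_sum, ← Finset.sum_add_distrib]
    refine Finset.sum_le_sum fun i _ => Finset.sum_le_sum fun a ha => ?_
    have hai : f a = i := by simpa using ha
    simpa only [map_add, map_smul, smul_eq_mul, Pi.add_apply, Pi.smul_apply] using
      perspective_log_convex (hw a) (le_fiberSum f hw hai) (hv a) (le_fiberSum f hv hai) hx hy

theorem routingEntropy_ge {w : A → ℝ} (hw : ∀ a, 0 ≤ w a) :
    -(Fintype.card A * ∑ a, w a) ≤ routingEntropy f d w := by
  have hterm : ∀ i, ∀ a ∈ univ.filter (fun a => f a = i), -∑ c, w c ≤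
      w a * Real.log (w a) - w a * Real.log (fiberSum f i w) := by
    intro i a ha
    have hai : f a = i := by simpa using ha
    have h := perspective_log_ge one_pos one_pos (hw a) (le_fiberSum f hw hai)
    have hle : fiberSum f i w ≤ ∑ c, w c := by
      rw [← sum_fiberSum f]
      exact Finset.single_le_sum (fun j _ => fiberSum_nonneg f hw j) (Finset.mem_univ i)
    simp only [sub_self, mul_zero, zero_add, div_one, mul_one] at h
    linarith [hw a]
  have hT : 0 ≤ ∑ c, w c := Finset.sum_nonneg fun a _ => hw a
  rw [routingEntropy_eq]
  calc -(Fintype.card A * ∑ a, w a) = ∑ i, ∑ a ∈ univ.filter (fun a => f a = i), -∑ c, w c := by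
        rw [Finset.sum_fiberwise univ f fun _ => -∑ c, w c]
        simp
    _ ≤ ∑ i ∈ univ.filter (fun i => i ≠ d), ∑ a ∈ univ.filter (fun a => f a = i), -∑ c, w c := by
        rw [← Finset.sum_filter_add_sum_filter_not univ (fun i => i ≠ d)
          fun i => ∑ a ∈ univ.filter (fun a => f a = i), -∑ c, w c]
        exact add_le_of_nonpos_right (Finset.sum_nonpos fun i _ => Finset.sum_nonpos
          fun a _ => neg_nonpos.2 hT)
    _ ≤ _ := Finset.sum_le_sum fun i _ => Finset.sum_le_sum (hterm i)

end FiberSum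

/-- The cost `x * s x` of a latency with strictly increasing nonnegative derivative eventually
dominates every linear function. -/
theorem exists_linear_lower_bound_cost {s s' : ℝ → ℝ}
    (hpos : ∀ x ∈ Set.Ici (0 : ℝ), 0 < s x)
    (hs : ∀ x ∈ Set.Ici (0 : ℝ), HasDerivWithinAt s (s' x) (Set.Ici 0) x)
    (hs'_nonneg : ∀ x ∈ Set.Ici (0 : ℝ), 0 ≤ s' x) (hs' : StrictMonoOn s' (Set.Ici 0)) (M : ℝ) :
    ∃ C, ∀ x, 0 ≤ x → M * x - C ≤ x * s x := by
  have hc : 0 < s' 1 := (hs'_nonneg 0 Set.self_mem_Ici).trans_lt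
    (hs' Set.self_mem_Ici (Set.mem_Ici.2 zero_le_one) zero_lt_one)
  refine ⟨(M + s' 1) ^ 2 / (4 * s' 1), fun x hx => ?_⟩
  have htan := tangent_le_of_monotoneOn_deriv hs hs'.monotoneOn zero_le_one hx
  have h1 : 0 < s 1 := hpos 1 (Set.mem_Ici.2 zero_le_one)
  have hmul : x * (s' 1 * (x - 1)) ≤ x * s x := mul_le_mul_of_nonneg_left (by linarith) hx
  have hsq : M * x - (M + s' 1) ^ 2 / (4 * s' 1) =
      x * (s' 1 * (x - 1)) - (2 * s' 1 * x - (M + s' 1)) ^ 2 / (4 * s' 1) := by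
    field_simp
    ring
  have : 0 ≤ (2 * s' 1 * x - (M + s' 1)) ^ 2 / (4 * s' 1) := by positivity
  linarith

theorem exists_forall_le_of_sublevel_bounded {A : Type*} {W : Set (A → ℝ)} {G : (A → ℝ) → ℝ}
    (hW : IsClosed W) (hne : W.Nonempty) (hW0 : ∀ w ∈ W, ∀ a, 0 ≤ w a) (hG : ContinuousOn G W)
    {C : ℝ} (hC : ∀ w ∈ W, ∀ a, w a ≤ G w + C) :
    ∃ w ∈ W, ∀ v ∈ W, G w ≤ G v := by
  obtain ⟨w₀, hw₀⟩ := hne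
  have hcpt : IsCompact (W ∩ Set.Icc (fun _ => 0) fun _ => G w₀ + C) := isCompact_Icc.inter_left hW
  obtain ⟨w, hw, hmin⟩ := hcpt.exists_isMinOn ⟨w₀, hw₀, hW0 w₀ hw₀, hC w₀ hw₀⟩
    (hG.mono Set.inter_subset_left)
  refine ⟨w, hw.1, fun v hv => ?_⟩
  by_cases hvC : G v ≤ G w₀
  · exact hmin ⟨hv, hW0 v hv, fun a => (hC v hv a).trans (by linarith)⟩
  · exact (hmin ⟨hw₀, hW0 w₀ hw₀, hC w₀ hw₀⟩).trans (not_le.1 hvC).le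

/-- Main theorem: the optimal toll exists, is unique, and induces the perturbed
socially optimal flow. -/
theorem optimal_toll_exists_unique_and_socially_optimal
    {A_O A I : Type*} [Fintype A_O] [Fintype A] [Fintype I]
    [Nonempty A_O] [Nonempty A]
    [DecidableEq A_O] [DecidableEq A] [DecidableEq I]
    (π : A → A_O) (tail head : A → I) (o d : I) (hod : o ≠ d)
    (g_o : ℝ) (hg : 0 < g_o)
    (s s' : A_O → ℝ → ℝ)
    (hs_cont : ∀ b, ContinuousOn (s b) (Set.Ici 0))
    (hs_pos : ∀ b, ∀ x ∈ Set.Ici (0 : ℝ), 0 < s b x)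
    (hs_mono : ∀ b, StrictMonoOn (s b) (Set.Ici 0))
    (hs_deriv : ∀ b, ∀ x ∈ Set.Ici (0 : ℝ), HasDerivWithinAt (s b) (s' b x) (Set.Ici 0) x)
    (hs'_cont : ∀ b, ContinuousOn (s' b) (Set.Ici 0))
    (hs'_nonneg : ∀ b, ∀ x ∈ Set.Ici (0 : ℝ), 0 ≤ s' b x)
    (hs'_strictmono : ∀ b, StrictMonoOn (s' b) (Set.Ici 0))
    (β : ℝ) (hβ : 0 < β)
    (W : Set (A → ℝ))
    (hW : W = {w : A → ℝ | (∀ a, 0 ≤ w a) ∧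
      (∀ i, i ≠ o → i ≠ d →
        ∑ a ∈ univ.filter (fun a => tail a = i), w a =
        ∑ a ∈ univ.filter (fun a => head a = i), w a) ∧
      ∑ a ∈ univ.filter (fun a => tail a = o), w a = g_o})
    (F : (A → ℝ) → (A_O → ℝ) → ℝ)
    (hF : F = fun w p =>
      (∑ b : A_O,
        ∫ u in (0 : ℝ)..(∑ a ∈ univ.filter (fun a => π a = b), w a), (s b u + p b)) +
      (1 / β) * ∑ i ∈ univ.filter (fun i => i ≠ d),
        ((∑ a ∈ univ.filter (fun a => tail a = i), w a * Real.log (w a)) -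
         (∑ a ∈ univ.filter (fun a => tail a = i), w a) *
           Real.log (∑ a ∈ univ.filter (fun a => tail a = i), w a)))
    (G : (A → ℝ) → ℝ)
    (hG : G = fun w =>
      (∑ b : A_O,
        (∑ a ∈ univ.filter (fun a => π a = b), w a) *
          s b (∑ a ∈ univ.filter (fun a => π a = b), w a)) +
      (1 / β) * ∑ i ∈ univ.filter (fun i => i ≠ d),
        ((∑ a ∈ univ.filter (fun a => tail a = i), w a * Real.log (w a)) -
         (∑ a ∈ univ.filter (fun a => tail a = i), w a) *
           Real.log (∑ a ∈ univ.filter (fun a => tail a = i), w a)))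
    (wbar : (A_O → ℝ) → (A → ℝ))
    (h_mem : ∀ p, wbar p ∈ W)
    (h_min : ∀ p, ∀ w ∈ W, F (wbar p) p ≤ F w p)
    (h_unique : ∀ p, ∀ w ∈ W, (∀ w' ∈ W, F w p ≤ F w' p) → w = wbar p)
    (h_pos : ∀ p a, 0 < wbar p a)
    (h_cont : Continuous wbar)
    (h_agg_bdd : ∀ p b,
      0 < ∑ a ∈ univ.filter (fun a => π a = b), wbar p a ∧
      ∑ a ∈ univ.filter (fun a => π a = b), wbar p a ≤ g_o) :
    (∃! pbar : A_O → ℝ, ∀ b : A_O,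
      pbar b = (∑ a ∈ univ.filter (fun a => π a = b), wbar pbar a) *
        s' b (∑ a ∈ univ.filter (fun a => π a = b), wbar pbar a)) ∧
    (∀ pbar : A_O → ℝ,
      (∀ b : A_O,
        pbar b = (∑ a ∈ univ.filter (fun a => π a = b), wbar pbar a) *
          s' b (∑ a ∈ univ.filter (fun a => π a = b), wbar pbar a)) →
      ∀ w ∈ W, G (wbar pbar) ≤ G w) := by
  have hWconv : Convex ℝ W := by
    rw [hW]
    rintro w ⟨hw0, hwc, hwo⟩ v ⟨hv0, hvc, hvo⟩ x y hx hy hxy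
    simp only [← fiberSum_apply] at hwc hwo hvc hvo
    simp only [Set.mem_ofPred_eq, ← fiberSum_apply, map_add, map_smul, smul_eq_mul]
    refine ⟨fun a => add_nonneg (mul_nonneg hx (hw0 a)) (mul_nonneg hy (hv0 a)),
      fun i hio hid => ?_, ?_⟩
    · rw [hwc i hio hid, hvc i hio hid]
    · rw [hwo, hvo, ← add_mul, hxy, one_mul]
  have hWclosed : IsClosed W := by
    rw [hW]
    simp only [← fiberSum_apply, Set.ofPred_and, Set.ofPred_forall]
    refine IsClosed.inter (isClosed_iInter fun a => ?_) (IsClosed.inter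
      (isClosed_iInter fun i => isClosed_iInter fun _ => isClosed_iInter fun _ => ?_) ?_)
    · exact isClosed_le continuous_const (continuous_apply a)
    · exact isClosed_eq (continuous_fiberSum tail i) (continuous_fiberSum head i)
    · exact isClosed_eq (continuous_fiberSum tail o) continuous_const
  have hW0 : ∀ w ∈ W, ∀ a, 0 ≤ w a := by
    intro w hw
    rw [hW] at hw
    exact hw.1
  have hL : ∀ b, ∀ w ∈ W, 0 ≤ fiberSum π b w := fun b w hw => fiberSum_nonneg π (hW0 w hw) b
  have hβ' : 0 ≤ 1 / β := by positivity
  set H : (A → ℝ) → ℝ := fun w => (1 / β) * routingEntropy tail d w with hHdef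
  have hH : ConvexOn ℝ W H :=
    ((convexOn_routingEntropy tail d).subset hW0 hWconv).smul hβ'
  have hHcont : Continuous H := continuous_const.mul (continuous_routingEntropy tail d)
  have hFeq : ∀ w p, F w p =
      ∑ b, (∫ u in (0 : ℝ)..fiberSum π b w, (s b u + p b)) + H w := by
    intro w p
    simp only [hF, hHdef, routingEntropy, fiberSum_apply]
  have hGeq : ∀ w, G w = ∑ b, fiberSum π b w * s b (fiberSum π b w) + H w := by
    intro w
    simp only [hG, hHdef, routingEntropy, fiberSum_apply]
  have hmarginal : ∀ b, StrictMonoOn (fun x => s b x + x * s' b x) (Set.Ici 0) := by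
    intro b x hx y hy hxy
    exact add_lt_add_of_lt_of_le (hs_mono b hx hy hxy)
      (mul_le_mul hxy.le (hs'_strictmono b hx hy hxy).le (hs'_nonneg b x hx) hy)
  have hFmin : ∀ p, ∀ w ∈ W, (∀ v ∈ W, F w p ≤ F v p) ↔ ∀ v ∈ W, 0 ≤
      ∑ b, (s b (fiberSum π b w) + p b) * (fiberSum π b v - fiberSum π b w) + (H v - H w) := by
    intro p w hw
    simp only [hFeq]
    refine isMinOn_iff_variational_inequality 
      (K := fun b x => ∫ u in (0 : ℝ)..x, (s b u + p b)) (k := fun b x => s b x + p b)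
      hH (fiberSum π) hL (fun b x hx => hasDerivWithinAt_integral_Ici ((hs_cont b).add continuousOn_const) hx)
      (fun b => (hs_mono b).monotoneOn.add_const (p b)) hw
  have hGmin : ∀ w ∈ W, (∀ v ∈ W, G w ≤ G v) ↔ ∀ v ∈ W, 0 ≤
      ∑ b, (s b (fiberSum π b w) + fiberSum π b w * s' b (fiberSum π b w)) *
        (fiberSum π b v - fiberSum π b w) + (H v - H w) := by
    intro w hw
    simp only [hGeq]
    refine isMinOn_iff_variational_inequality (K := fun b x => x * s b x)
      (k := fun b x => s b x + x * s' b x) hH (fiberSum π) hL (fun b x hx => ?_) (fun b => (hmarginal b).monotoneOn) hw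
    simpa using (hasDerivWithinAt_id x (Set.Ici 0)).fun_mul (hs_deriv b x hx)
  have hoptimal : ∀ p : A_O → ℝ,
      (∀ b, p b = fiberSum π b (wbar p) * s' b (fiberSum π b (wbar p))) →
      ∀ w ∈ W, G (wbar p) ≤ G w := by
    intro p hp
    have hvi := (hFmin p (wbar p) (h_mem p)).1 (h_min p)
    simp only [hp] at hvi
    exact (hGmin (wbar p) (h_mem p)).2 hvi
  have hexists : ∃ w ∈ W, ∀ v ∈ W, G w ≤ G v := by
    choose C hC using fun b => exists_linear_lower_bound_cost (hs_pos b) (hs_deriv b)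
      (hs'_nonneg b) (hs'_strictmono b) (1 / β * Fintype.card A + 1)
    refine exists_forall_le_of_sublevel_bounded (C := ∑ b, C b) hWclosed ⟨_, h_mem 0⟩ hW0 ?_ ?_
    · refine ContinuousOn.congr ?_ fun w _ => hGeq w
      refine (continuousOn_finsetSum _ fun b _ => ?_).add hHcont.continuousOn
      have hcont := (continuous_fiberSum π b).continuousOn (s := W)
      exact hcont.mul ((hs_cont b).comp hcont (hL b))
    · intro w hw a
      have hcost := Finset.sum_le_sum fun b (_ : b ∈ univ) => hC b (fiberSum π b w) (hL b w hw)
      rw [Finset.sum_sub_distrib, ← Finset.mul_sum, sum_fiberSum] at hcost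
      have hent := mul_le_mul_of_nonneg_left (routingEntropy_ge tail d (hW0 w hw)) hβ'
      have hsingle := Finset.single_le_sum (fun c _ => hW0 w hw c) (Finset.mem_univ a)
      rw [hGeq]
      simp only [hHdef]
      linarith
  simp only [← fiberSum_apply]
  refine ⟨?_, hoptimal⟩
  obtain ⟨w, hw, hwmin⟩ := hexists
  have hwfix : w = wbar fun b => fiberSum π b w * s' b (fiberSum π b w) :=
    h_unique _ w hw ((hFmin _ w hw).2 ((hGmin w hw).1 hwmin))
  refine ⟨fun b => fiberSum π b w * s' b (fiberSum π b w), fun b => by rw [← hwfix], ?_⟩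
  intro q hq
  have hvq := (hGmin (wbar q) (h_mem q)).1 (hoptimal q hq) w hw
  have hvw := (hGmin w hw).1 hwmin (wbar q) (h_mem q)
  have hterm := fun b => (hmarginal b).cross_sum_nonpos (hL b w hw) (hL b _ (h_mem q))
  have hsum := Finset.sum_eq_zero_iff_of_nonpos (fun b (_ : b ∈ univ) => (hterm b).1)
  have hzero := hsum.1 (le_antisymm (Finset.sum_nonpos fun b _ => (hterm b).1) (by
    rw [Finset.sum_add_distrib]
    linarith))
  funext b
  rw [hq b, (hterm b).2 (hzero b (Finset.mem_univ b))]
end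

section
/- (Lyapunov decrease inequality for the toll dynamics.) For every p ∈ ℝ^{A_O}: ∑_{b ∈ A_O} ( (p_b − p̄_b)/θ_b ) · ( −p_b + θ_b·f(p)_b ) ≤ −2·V(p), where V(p) := (1/2) ∑_{b ∈ A_O} (p_b − p̄_b)² / θ_b. -/
open Finset

/-- Lyapunov decrease inequality for the continuous-time toll dynamics. -/
theorem toll_dynamics_lyapunov_decrease
    {A_O : Type*} [Fintype A_O] [Nonempty A_O]
    (θ : A_O → ℝ) (hθ : ∀ b, 0 < θ b)
    (f : (A_O → ℝ) → (A_O → ℝ))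
    (hf_mono : ∀ p p' : A_O → ℝ, ∑ b : A_O, (f p' b - f p b) * (p' b - p b) ≤ 0)
    (pbar : A_O → ℝ)
    (h_fixed : ∀ b, pbar b = θ b * f pbar b)
    (V : (A_O → ℝ) → ℝ)
    (hV : V = fun p => (1 / 2) * ∑ b : A_O, (p b - pbar b) ^ 2 / θ b) :
    ∀ p : A_O → ℝ,
      ∑ b : A_O, ((p b - pbar b) / θ b) * (-p b + θ b * f p b) ≤ -2 * V p := by
  intro p
  have hterm : ∀ b, ((p b - pbar b) / θ b) * (-p b + θ b * f p b) =
      (f p b - f pbar b) * (p b - pbar b) - (p b - pbar b) ^ 2 / θ b := by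
    intro b
    have hb := (hθ b).ne'
    have hfix : f pbar b = pbar b / θ b := by
      rw [eq_div_iff hb, mul_comm]
      exact (h_fixed b).symm
    rw [hfix]
    field_simp
    ring
  simp only [hV, hterm, Finset.sum_sub_distrib]
  linarith [hf_mono pbar p]
end

section
/- (Exponential convergence of the continuous-time toll dynamics.) Let p : [0, ∞) → ℝ^{A_O} be differentiable with p_b'(t) = −p_b(t) + θ_b·f(p(t))_b for all t ≥ 0 and b ∈ A_O. Then V(p(t)) ≤ e^{−2t}·V(p(0)) for all t ≥ 0, where V(q) := (1/2) ∑_{b ∈ A_O} (q_b − p̄_b)² / θ_b; in particular, p(t) converges to p̄ exponentially as t → ∞. -/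
open Finset

/-- A differential inequality `u' ≤ -c u` on `[0, ∞)` forces exponential decay at rate `c`. -/
theorem le_exp_neg_mul_of_hasDerivAt_le {u u' : ℝ → ℝ} {c : ℝ}
    (hu : ∀ t, 0 ≤ t → HasDerivAt u (u' t) t) (hle : ∀ t, 0 ≤ t → u' t ≤ -c * u t)
    {t : ℝ} (ht : 0 ≤ t) : u t ≤ Real.exp (-c * t) * u 0 := by
  have hderiv : ∀ s, 0 ≤ s → HasDerivAt (fun s => Real.exp (c * s) * u s)
      (Real.exp (c * s) * (u' s + c * u s)) s := fun s hs => by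
    have h := (((hasDerivAt_id s).const_mul c).exp).mul (hu s hs)
    refine h.congr_deriv ?_
    simp only [id]
    ring
  have hanti : AntitoneOn (fun s => Real.exp (c * s) * u s) (Set.Ici 0) := by
    refine antitoneOn_of_deriv_nonpos (convex_Ici 0)
      (fun s hs => (hderiv s hs).continuousAt.continuousWithinAt) ?_ ?_
    · intro s hs
      exact (hderiv s (interior_subset hs)).differentiableAt.differentiableWithinAt
    · intro s hs
      have hs' : 0 ≤ s := interior_subset hs
      rw [(hderiv s hs').deriv]
      exact mul_nonpos_of_nonneg_of_nonpos (Real.exp_pos _).le (by linarith [hle s hs'])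
  have h : Real.exp (c * t) * u t ≤ u 0 := by
    simpa using hanti Set.self_mem_Ici ht ht
  calc u t = Real.exp (-c * t) * (Real.exp (c * t) * u t) := by
        rw [← mul_assoc, ← Real.exp_add]
        simp
    _ ≤ Real.exp (-c * t) * u 0 := mul_le_mul_of_nonneg_left h (Real.exp_pos _).le

/-- If a weighted sum of squared coordinate errors tends to zero, the family converges. -/
theorem tendsto_of_tendsto_sum_sq_div {α ι : Type*} [Fintype ι] {l : Filter α}
    {w : ι → ℝ} (hw : ∀ b, 0 < w b) {p : α → ι → ℝ} {q : ι → ℝ}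
    (h : Filter.Tendsto (fun t => ∑ b, (p t b - q b) ^ 2 / w b) l (nhds 0)) :
    Filter.Tendsto p l (nhds q) := by
  rw [tendsto_pi_nhds]
  intro b
  have hdiv : Filter.Tendsto (fun t => (p t b - q b) ^ 2 / w b) l (nhds 0) :=
    squeeze_zero (fun t => div_nonneg (sq_nonneg _) (hw b).le)
      (fun t => Finset.single_le_sum (f := fun b => (p t b - q b) ^ 2 / w b)
        (fun b _ => div_nonneg (sq_nonneg _) (hw b).le) (Finset.mem_univ b)) h
  have hsq : Filter.Tendsto (fun t => (p t b - q b) ^ 2) l (nhds 0) := by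
    simpa [div_mul_cancel₀ _ (hw b).ne'] using hdiv.mul_const (w b)
  have habs : Filter.Tendsto (fun t => |p t b - q b|) l (nhds 0) := by
    simpa [Real.sqrt_sq_eq_abs] using hsq.sqrt
  exact tendsto_sub_nhds_zero_iff.mp ((tendsto_zero_iff_abs_tendsto_zero _).mpr habs)

/-- Exponential convergence of the continuous-time toll dynamics:
`V(p(t)) ≤ e^{-2t} V(p(0))` along trajectories, and `p(t) → p̄`. -/
theorem toll_dynamics_exponential_convergence
    {A_O : Type*} [Fintype A_O] [Nonempty A_O]
    (θ : A_O → ℝ) (hθ : ∀ b, 0 < θ b)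
    (f : (A_O → ℝ) → (A_O → ℝ))
    (hf_mono : ∀ p p' : A_O → ℝ, ∑ b : A_O, (f p' b - f p b) * (p' b - p b) ≤ 0)
    (pbar : A_O → ℝ)
    (h_fixed : ∀ b, pbar b = θ b * f pbar b)
    (V : (A_O → ℝ) → ℝ)
    (hV : V = fun q => (1 / 2) * ∑ b : A_O, (q b - pbar b) ^ 2 / θ b)
    (p : ℝ → (A_O → ℝ))
    (hp : ∀ t ∈ Set.Ici (0 : ℝ), ∀ b : A_O,
      HasDerivAt (fun τ => p τ b) (-(p t b) + θ b * f (p t) b) t) :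
    (∀ t ∈ Set.Ici (0 : ℝ), V (p t) ≤ Real.exp (-2 * t) * V (p 0)) ∧
    Filter.Tendsto p Filter.atTop (nhds pbar) := by
  have hderiv : ∀ t, 0 ≤ t → HasDerivAt (fun τ => V (p τ))
      ((1 / 2) * ∑ b, 2 * (p t b - pbar b) * (-(p t b) + θ b * f (p t) b) / θ b) t := by
    intro t ht
    subst hV
    refine HasDerivAt.const_mul _ (HasDerivAt.fun_sum fun b _ => ?_)
    simpa using (((hp t ht b).sub_const (pbar b)).pow 2).div_const (θ b)
  have hle : ∀ t, 0 ≤ t →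
      (1 / 2) * ∑ b, 2 * (p t b - pbar b) * (-(p t b) + θ b * f (p t) b) / θ b
        ≤ -2 * V (p t) := by
    intro t _
    have hsplit : (1 / 2) * ∑ b, 2 * (p t b - pbar b) * (-(p t b) + θ b * f (p t) b) / θ b
        = -2 * V (p t) + ∑ b, (f (p t) b - f pbar b) * (p t b - pbar b) := by
      simp only [hV, Finset.mul_sum, ← Finset.sum_add_distrib]
      refine Finset.sum_congr rfl fun b _ => ?_
      have hb := (hθ b).ne'
      rw [h_fixed b]
      field_simp
      ring
    linarith [hf_mono pbar (p t)]
  have hdecay : ∀ t ∈ Set.Ici (0 : ℝ), V (p t) ≤ Real.exp (-2 * t) * V (p 0) :=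
    fun t ht => le_exp_neg_mul_of_hasDerivAt_le hderiv hle ht
  refine ⟨hdecay, tendsto_of_tendsto_sum_sq_div hθ ?_⟩
  have hexp : Filter.Tendsto (fun t : ℝ => 2 * (Real.exp (-2 * t) * V (p 0)))
      Filter.atTop (nhds 0) := by
    have h := Real.tendsto_exp_atBot.comp
      (Filter.tendsto_id.const_mul_atTop_of_neg (show (-2 : ℝ) < 0 by norm_num))
    simpa using (h.mul_const (V (p 0))).const_mul 2
  refine squeeze_zero' (Filter.Eventually.of_forall fun t =>
    Finset.sum_nonneg fun b _ => div_nonneg (sq_nonneg _) (hθ b).le) ?_ hexp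
  filter_upwards [Filter.eventually_ge_atTop 0] with t ht
  have hVt : V (p t) = (1 / 2) * ∑ b, (p t b - pbar b) ^ 2 / θ b := by rw [hV]
  linarith [hdecay t ht]
end
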